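/- arXiv:2308.11393 — 5 statements merged into one kernel-verified Lean document; each statement's English description precedes it below -/
import Mathlib

section
/- Let H_u(t) = {z ∈ ℝ^d : ⟨z,u⟩ ≤ t} and let 𝓗₀ be the countable family of halfspaces H_u(t) over all rational t and all u from a fixed countable dense subset of the unit sphere S^{d−1}. If μ is either a Borel probability measure on ℝ^d or a finite signed measure with finite support, then for every α, the intersection of all closed halfspaces H with μ(H) > μ(ℝ^d) − α equals the intersection of all H ∈ 𝓗₀ with μ(H) > μ(ℝ^d) − α. -/
open MeasureTheory Filter Set
open scoped RealInnerProductSpace ENNReal Topology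

noncomputable section

/-- A closed halfspace of `ℝ^d`. -/
def IsHalfspace {d : ℕ} (H : Set (EuclideanSpace ℝ (Fin d))) : Prop :=
  ∃ (u : EuclideanSpace ℝ (Fin d)) (t : ℝ), ‖u‖ = 1 ∧ H = {z | ⟪z, u⟫ ≤ t}

/-- On a bounded set, a closed halfspace can be separated from a farther opposite halfspace by a
halfspace with rational threshold and normal in a dense set. -/
lemma exists_rat_halfspace_separating {E : Type*} [NormedAddCommGroup E] [InnerProductSpace ℝ E]
    {S : Set E} {u : E} (hu : u ∈ closure S) {t s : ℝ} (hts : t < s) (R : ℝ) :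
    ∃ v ∈ S, ∃ q : ℚ, ∀ z : E, ‖z‖ ≤ R →
      (⟪z, u⟫ ≤ t → ⟪z, v⟫ ≤ (q : ℝ)) ∧ (s ≤ ⟪z, u⟫ → (q : ℝ) < ⟪z, v⟫) := by
  obtain ⟨q, htq, hqs⟩ := exists_rat_btwn hts
  set δ := min ((q : ℝ) - t) (s - q)
  have hδ : 0 < δ := lt_min (sub_pos.2 htq) (sub_pos.2 hqs)
  have hR : 0 < |R| + 1 := by positivity
  obtain ⟨v, hvS, huv⟩ := Metric.mem_closure_iff.1 hu (δ / (|R| + 1)) (div_pos hδ hR)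
  rw [dist_eq_norm, lt_div_iff₀ hR] at huv
  refine ⟨v, hvS, q, fun z hz => ?_⟩
  have hzR : ‖z‖ ≤ |R| + 1 := by linarith [le_abs_self R]
  have hinner : |⟪z, u⟫ - ⟪z, v⟫| < δ := by
    rw [← inner_sub_right]
    calc |⟪z, u - v⟫| ≤ ‖z‖ * ‖u - v‖ := abs_real_inner_le_norm _ _
      _ ≤ (|R| + 1) * ‖u - v‖ := by gcongr
      _ < δ := by linarith
  have h₁ : δ ≤ (q : ℝ) - t := min_le_left _ _
  have h₂ : δ ≤ s - q := min_le_right _ _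
  rw [abs_lt] at hinner
  constructor <;> intro h <;> linarith [hinner.1, hinner.2]

lemma measurableSet_inner_le {d : ℕ} (u : EuclideanSpace ℝ (Fin d)) (t : ℝ) :
    MeasurableSet {z : EuclideanSpace ℝ (Fin d) | ⟪z, u⟫ ≤ t} :=
  (isClosed_le (by fun_prop) continuous_const).measurableSet

/-- A nonnegative signed measure is monotone on measurable sets. -/
lemma signedMeasure_mono_of_nonneg {X : Type*} [MeasurableSpace X] {μ : SignedMeasure X}
    (hμ : ∀ A, MeasurableSet A → 0 ≤ μ A) {A B : Set X} (hA : MeasurableSet A)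
    (hB : MeasurableSet B) (hAB : A ⊆ B) : μ A ≤ μ B := by
  have h := VectorMeasure.of_add_of_sdiff (v := μ) hA hB hAB
  linarith [hμ _ (hB.diff hA)]

/-- A signed measure vanishing off `F` takes equal values on measurable sets with the same trace
on `F`. -/
lemma signedMeasure_congr_of_inter_eq {X : Type*} [MeasurableSpace X] {μ : SignedMeasure X}
    {F : Set X} (hμ : ∀ A, MeasurableSet A → Disjoint A F → μ A = 0) {A B : Set X}
    (hA : MeasurableSet A) (hB : MeasurableSet B) (hAB : ∀ z ∈ F, z ∈ A ↔ z ∈ B) :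
    μ A = μ B := by
  have h₁ := VectorMeasure.of_add_of_sdiff (v := μ) (hA.inter hB) hA inter_subset_left
  have h₂ := VectorMeasure.of_add_of_sdiff (v := μ) (hA.inter hB) hB inter_subset_right
  rw [hμ _ (hA.diff (hA.inter hB)) (Set.disjoint_left.2 fun z hz hzF =>
    hz.2 ⟨hz.1, (hAB z hzF).1 hz.1⟩)] at h₁
  rw [hμ _ (hB.diff (hA.inter hB)) (Set.disjoint_left.2 fun z hz hzF =>
    hz.2 ⟨(hAB z hzF).2 hz.1, hz.1⟩)] at h₂
  linarith

/-- The mass of a set is approximated by the mass of its bounded parts. -/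
lemma exists_lt_signedMeasure_inter_closedBall {E : Type*} [NormedAddCommGroup E]
    [MeasurableSpace E] [OpensMeasurableSpace E] (μ : SignedMeasure E) {A : Set E}
    (hA : MeasurableSet A) {c : ℝ} (hc : c < μ A) (r : ℝ) :
    ∃ R, r ≤ R ∧ c < μ (A ∩ Metric.closedBall 0 R) := by
  have hmono : Monotone fun n : ℕ => A ∩ Metric.closedBall (0 : E) n := fun m n hmn =>
    inter_subset_inter_right _ (Metric.closedBall_subset_closedBall (by exact_mod_cast hmn))
  have hlim := μ.tendsto_vectorMeasure_iUnion_atTop_nat hmono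
    fun n => hA.inter Metric.isClosed_closedBall.measurableSet
  rw [← inter_iUnion, Metric.iUnion_closedBall_nat, inter_univ] at hlim
  obtain ⟨n, hn, hrn⟩ := ((hlim.eventually (lt_mem_nhds hc)).and
    (tendsto_natCast_atTop_atTop.eventually_ge_atTop r)).exists
  exact ⟨n, hrn, hn⟩

/-- The intersection of all closed halfspaces `H` with `μ H > μ(ℝ^d) - α` coincides with the
intersection taken only over halfspaces `H_u(t)` with rational `t` and `u` from a fixed
countable dense subset of the unit sphere, provided `μ` is a probability measure or a
finite signed measure with finite support. -/
theorem trimmedRegion_countably_determined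
    {d : ℕ} (S : Set (EuclideanSpace ℝ (Fin d))) (hScount : S.Countable)
    (hSsub : S ⊆ Metric.sphere (0 : EuclideanSpace ℝ (Fin d)) 1)
    (hSdense : Metric.sphere (0 : EuclideanSpace ℝ (Fin d)) 1 ⊆ closure S)
    (μ : SignedMeasure (EuclideanSpace ℝ (Fin d)))
    (hμ : ((∀ A : Set (EuclideanSpace ℝ (Fin d)), MeasurableSet A → 0 ≤ μ A) ∧
            μ Set.univ = 1) ∨
          (∃ F : Finset (EuclideanSpace ℝ (Fin d)),
            ∀ A : Set (EuclideanSpace ℝ (Fin d)), MeasurableSet A →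
              Disjoint A (F : Set (EuclideanSpace ℝ (Fin d))) → μ A = 0))
    (α : ℝ) :
    ⋂₀ {H | IsHalfspace H ∧ μ Set.univ - α < μ H} =
      ⋂₀ {H | (∃ u ∈ S, ∃ t : ℚ, H = {z | ⟪z, u⟫ ≤ (t : ℝ)}) ∧ μ Set.univ - α < μ H} := by
  refine Subset.antisymm (sInter_subset_sInter ?_) ?_
  · rintro H ⟨⟨u, hu, t, rfl⟩, hH⟩
    exact ⟨⟨u, t, by simpa using hSsub hu, rfl⟩, hH⟩
  rintro x hx H ⟨⟨u, t, hu, rfl⟩, hH⟩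
  by_contra hxt
  replace hxt : t < ⟪x, u⟫ := not_le.1 hxt
  have huS : u ∈ closure S := hSdense (by simpa using hu)
  suffices h : ∃ v ∈ S, ∃ q : ℚ, (q : ℝ) < ⟪x, v⟫ ∧ μ univ - α < μ {z | ⟪z, v⟫ ≤ (q : ℝ)} by
    obtain ⟨v, hv, q, hxq, hq⟩ := h
    exact hxq.not_ge (hx _ ⟨⟨v, hv, q, rfl⟩, hq⟩)
  rcases hμ with ⟨hpos, -⟩ | ⟨F, hF⟩
  · obtain ⟨R, hxR, hR⟩ :=
      exists_lt_signedMeasure_inter_closedBall μ (measurableSet_inner_le u t) hH ‖x‖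
    obtain ⟨v, hv, q, hq⟩ := exists_rat_halfspace_separating huS hxt R
    refine ⟨v, hv, q, (hq x hxR).2 le_rfl, hR.trans_le ?_⟩
    exact signedMeasure_mono_of_nonneg hpos
      ((measurableSet_inner_le u t).inter Metric.isClosed_closedBall.measurableSet)
      (measurableSet_inner_le v q) fun z hz => (hq z (by simpa using hz.2)).1 hz.1
  · classical
    obtain ⟨R, hR⟩ := ((insert x F).image (‖·‖)).exists_le
    replace hR : ∀ z ∈ insert x F, ‖z‖ ≤ R := fun z hz => hR _ (Finset.mem_image_of_mem _ hz)
    have hne : ((insert x F).filter fun z => t < ⟪z, u⟫).Nonempty :=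
      ⟨x, by simpa using hxt⟩
    obtain ⟨y, hy, hmin⟩ := Finset.exists_min_image _ (fun z => ⟪z, u⟫) hne
    obtain ⟨v, hv, q, hq⟩ := exists_rat_halfspace_separating huS (Finset.mem_filter.1 hy).2 R
    have hfar : ∀ z ∈ insert x F, t < ⟪z, u⟫ → (q : ℝ) < ⟪z, v⟫ := fun z hz htz =>
      (hq z (hR z hz)).2 (hmin z (Finset.mem_filter.2 ⟨hz, htz⟩))
    refine ⟨v, hv, q, hfar x (Finset.mem_insert_self _ _) hxt, hH.trans_eq ?_⟩
    refine signedMeasure_congr_of_inter_eq hF (measurableSet_inner_le u t)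
      (measurableSet_inner_le v q) fun z hz => ?_
    have hz' : z ∈ insert x F := Finset.mem_insert_of_mem hz
    exact ⟨(hq z (hR z hz')).1, fun h => not_lt.1 fun htz => (hfar z hz' htz).not_ge h⟩

end
end

section
/- The topological boundary of the empirical depth trimmed region R_n(α) is contained in the union of all affine subspaces of ℝ^d generated by i-tuples of points from {X_1, …, X_n}, over i = 1, …, d. -/
open MeasureTheory Filter Set
open scoped RealInnerProductSpace ENNReal Topology

noncomputable section

/-- The weighted empirical measure `μ_n(H) = n⁻¹ ∑_{i<n} ξ_i 1_H(X_i)` evaluated at a set `H`,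
for a given realisation of the weights `ξ` and the sample points `X`. -/
def empMeas {d : ℕ} (ξ : ℕ → ℝ) (X : ℕ → EuclideanSpace ℝ (Fin d)) (n : ℕ)
    (H : Set (EuclideanSpace ℝ (Fin d))) : ℝ :=
  (n : ℝ)⁻¹ * ∑ i ∈ Finset.range n, ξ i * H.indicator (fun _ => (1 : ℝ)) (X i)

/-- The sample mean `ξ̄_n` of the weights. -/
def xiBar (ξ : ℕ → ℝ) (n : ℕ) : ℝ := (n : ℝ)⁻¹ * ∑ i ∈ Finset.range n, ξ i

/-- The empirical depth trimmed region `R_n(α)`. -/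
def empRegion {d : ℕ} (ξ : ℕ → ℝ) (X : ℕ → EuclideanSpace ℝ (Fin d)) (n : ℕ) (α : ℝ) :
    Set (EuclideanSpace ℝ (Fin d)) :=
  ⋂₀ {H | IsHalfspace H ∧ xiBar ξ n - α < empMeas ξ X n H}

/-- A point off the affine span of `s` is separated from `s` by a vector whose inner products
with all the differences `p - x`, `p ∈ s`, are `-1`. -/
theorem exists_forall_inner_sub_eq_neg_one {E : Type*} [NormedAddCommGroup E]
    [InnerProductSpace ℝ E] [FiniteDimensional ℝ E] {s : Set E} {x : E}
    (hx : x ∉ affineSpan ℝ s) : ∃ v : E, ∀ p ∈ s, ⟪p - x, v⟫ = -1 := by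
  rcases s.eq_empty_or_nonempty with rfl | ⟨p₀, hp₀⟩
  · exact ⟨0, by simp⟩
  have : Nonempty (affineSpan ℝ s) := ⟨⟨p₀, subset_affineSpan ℝ s hp₀⟩⟩
  set q : affineSpan ℝ s := EuclideanGeometry.orthogonalProjection (affineSpan ℝ s) x
  have hne : x - (q : E) ≠ 0 := fun h => hx (sub_eq_zero.1 h ▸ q.2)
  have hnorm : ‖x - (q : E)‖ ^ 2 ≠ 0 := pow_ne_zero 2 (norm_ne_zero_iff.2 hne)
  refine ⟨(‖x - (q : E)‖ ^ 2)⁻¹ • (x - (q : E)), fun p hp => ?_⟩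
  have horth : ⟪p - (q : E), x - (q : E)⟫ = 0 :=
    Submodule.inner_right_of_mem_orthogonal
      (AffineSubspace.vsub_mem_direction (subset_affineSpan ℝ s hp) q.2)
      (EuclideanGeometry.vsub_orthogonalProjection_mem_direction_orthogonal (affineSpan ℝ s) x)
  have hinner : ⟪p - x, x - (q : E)⟫ = -‖x - (q : E)‖ ^ 2 := by
    rw [← sub_sub_sub_cancel_right p x (q : E), inner_sub_left, horth,
      real_inner_self_eq_norm_sq, zero_sub]
  rw [inner_smul_right, hinner]
  field_simp

/-- A point of the affine span of a finite set lying in a hyperplane of `ℝ^d` is in the affine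
span of at most `d` points of the set. -/
theorem exists_finset_card_le_mem_affineSpan {d : ℕ} {s : Set (EuclideanSpace ℝ (Fin d))}
    (hs : s.Finite) {x u : EuclideanSpace ℝ (Fin d)} (hu : u ≠ 0)
    (hsu : ∀ p ∈ s, ⟪p - x, u⟫ = 0) (hx : x ∈ affineSpan ℝ s) :
    ∃ T : Finset (EuclideanSpace ℝ (Fin d)), (T : Set (EuclideanSpace ℝ (Fin d))) ⊆ s ∧
      1 ≤ T.card ∧ T.card ≤ d ∧
      x ∈ affineSpan ℝ (T : Set (EuclideanSpace ℝ (Fin d))) := by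
  obtain ⟨t, hts, hspan, hind⟩ := exists_affineIndependent ℝ (EuclideanSpace ℝ (Fin d)) s
  lift t to Finset (EuclideanSpace ℝ (Fin d)) using hs.subset hts
  have hxt : x ∈ affineSpan ℝ (t : Set (EuclideanSpace ℝ (Fin d))) := hspan ▸ hx
  refine ⟨t, hts, ?_, ?_, hxt⟩
  · rw [Nat.one_le_iff_ne_zero, Finset.card_ne_zero, ← Finset.coe_nonempty,
      ← affineSpan_nonempty ℝ]
    exact ⟨x, hxt⟩
  · have hle : vectorSpan ℝ (t : Set (EuclideanSpace ℝ (Fin d))) ≤ (ℝ ∙ u)ᗮ := by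
      rw [vectorSpan_def, Submodule.span_le]
      rintro _ ⟨p, hp, q, hq, rfl⟩
      rw [SetLike.mem_coe, Submodule.mem_orthogonal_singleton_iff_inner_left]
      change ⟪p - q, u⟫ = 0
      rw [← sub_sub_sub_cancel_right p q x, inner_sub_left, hsu p (hts hp), hsu q (hts hq), sub_zero]
    have hne : vectorSpan ℝ (t : Set (EuclideanSpace ℝ (Fin d))) ≠ ⊤ := fun htop => by
      have hmem : u ∈ (ℝ ∙ u)ᗮ := hle (htop ▸ Submodule.mem_top)
      rw [Submodule.mem_orthogonal_singleton_iff_inner_left, inner_self_eq_zero] at hmem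
      exact hu hmem
    have hlt := Submodule.finrank_lt hne
    rw [finrank_euclideanSpace_fin] at hlt
    have hcard := hind.card_le_finrank_succ
    rw [Subtype.range_coe] at hcard
    simp only [Finset.mem_coe, Fintype.card_coe] at hcard
    lia

theorem IsHalfspace.of_ne_zero {d : ℕ} {w : EuclideanSpace ℝ (Fin d)} (hw : w ≠ 0) (t : ℝ) :
    IsHalfspace {z | ⟪z, w⟫ ≤ t} := by
  have hpos : 0 < ‖w‖ := norm_pos_iff.2 hw
  refine ⟨‖w‖⁻¹ • w, ‖w‖⁻¹ * t, norm_smul_inv_norm hw, ?_⟩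
  ext z
  rw [mem_ofPred_eq, mem_ofPred_eq, inner_smul_right, mul_le_mul_iff_right₀ (inv_pos.2 hpos)]

theorem IsHalfspace.isClosed {d : ℕ} {H : Set (EuclideanSpace ℝ (Fin d))} (hH : IsHalfspace H) :
    IsClosed H := by
  obtain ⟨u, t, -, rfl⟩ := hH
  exact isClosed_le (by fun_prop) continuous_const

theorem isClosed_empRegion {d : ℕ} (ξ : ℕ → ℝ) (X : ℕ → EuclideanSpace ℝ (Fin d)) (n : ℕ)
    (α : ℝ) : IsClosed (empRegion ξ X n α) :=
  isClosed_sInter fun _ hH => hH.1.isClosed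

theorem empMeas_congr {d : ℕ} (ξ : ℕ → ℝ) {X : ℕ → EuclideanSpace ℝ (Fin d)} {n : ℕ}
    {H K : Set (EuclideanSpace ℝ (Fin d))} (h : ∀ i < n, (X i ∈ H ↔ X i ∈ K)) :
    empMeas ξ X n H = empMeas ξ X n K := by
  classical
  unfold empMeas
  congr 1
  refine Finset.sum_congr rfl fun i hi => ?_
  simp only [indicator_apply, h i (Finset.mem_range.1 hi)]

/-- At a boundary point `x` of the trimmed region there are halfspaces `⟪z - x, u k⟫ ≤ s k`
taking part in the intersection whose boundaries converge to a hyperplane through `x`. -/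
theorem exists_tendsto_halfspaces_of_mem_frontier {d : ℕ} {ξ : ℕ → ℝ}
    {X : ℕ → EuclideanSpace ℝ (Fin d)} {n : ℕ} {α : ℝ} {x : EuclideanSpace ℝ (Fin d)}
    (hx : x ∈ frontier (empRegion ξ X n α)) :
    ∃ (u : ℕ → EuclideanSpace ℝ (Fin d)) (s : ℕ → ℝ) (u₀ : EuclideanSpace ℝ (Fin d)),
      u₀ ≠ 0 ∧ Tendsto u atTop (𝓝 u₀) ∧ Tendsto s atTop (𝓝 0) ∧
      ∀ k, xiBar ξ n - α < empMeas ξ X n {z | ⟪z - x, u k⟫ ≤ s k} := by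
  have hxR : x ∈ empRegion ξ X n α := (isClosed_empRegion ξ X n α).frontier_subset hx
  rw [frontier_eq_closure_inter_closure] at hx
  obtain ⟨y, hy, hyx⟩ := mem_closure_iff_seq_limit.1 hx.2
  have hex : ∀ k, ∃ (u : EuclideanSpace ℝ (Fin d)) (t : ℝ), ‖u‖ = 1 ∧
      xiBar ξ n - α < empMeas ξ X n {z | ⟪z, u⟫ ≤ t} ∧ t < ⟪y k, u⟫ := by
    intro k
    have hk := hy k
    simp only [empRegion, mem_compl_iff, mem_sInter, not_forall] at hk
    obtain ⟨_, ⟨⟨u, t, hu, rfl⟩, hH⟩, hyk⟩ := hk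
    exact ⟨u, t, hu, hH, not_le.1 hyk⟩
  choose u t hu hH hyt using hex
  have hxt : ∀ k, ⟪x, u k⟫ ≤ t k := fun k => hxR _ ⟨⟨u k, t k, hu k, rfl⟩, hH k⟩
  have hs : Tendsto (fun k => t k - ⟪x, u k⟫) atTop (𝓝 0) := by
    refine squeeze_zero (fun k => sub_nonneg.2 (hxt k)) (fun k => ?_)
      (tendsto_iff_norm_sub_tendsto_zero.1 hyx)
    calc t k - ⟪x, u k⟫ ≤ ⟪y k - x, u k⟫ := by rw [inner_sub_left]; linarith [hyt k]
      _ ≤ ‖y k - x‖ * ‖u k‖ := real_inner_le_norm _ _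
      _ = ‖y k - x‖ := by rw [hu k, mul_one]
  obtain ⟨u₀, hu₀, φ, hφ, hlim⟩ :=
    (isCompact_sphere (0 : EuclideanSpace ℝ (Fin d)) 1).tendsto_subseq
      (x := u) fun k => by simp [hu k]
  refine ⟨u ∘ φ, fun k => t (φ k) - ⟪x, u (φ k)⟫, u₀, ?_, hlim, hs.comp hφ.tendsto_atTop,
    fun k => ?_⟩
  · rintro rfl
    simp at hu₀
  · simpa [inner_sub_left] using hH (φ k)

/-- The boundary of the empirical depth trimmed region `R_n(α)` is contained in the union of
all affine subspaces generated by `i`-tuples of the sample points, `i = 1, …, d`. -/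
theorem frontier_empRegion_subset_affineSpans
    {d : ℕ} (ξ : ℕ → ℝ) (X : ℕ → EuclideanSpace ℝ (Fin d)) (n : ℕ) (α : ℝ) :
    frontier (empRegion ξ X n α) ⊆
      ⋃ T ∈ {T : Finset (EuclideanSpace ℝ (Fin d)) |
          (T : Set (EuclideanSpace ℝ (Fin d))) ⊆ X '' (Finset.range n) ∧
          1 ≤ T.card ∧ T.card ≤ d},
        (affineSpan ℝ (T : Set (EuclideanSpace ℝ (Fin d))) :
          Set (EuclideanSpace ℝ (Fin d))) := by
  intro x hx
  have hxR : x ∈ empRegion ξ X n α := (isClosed_empRegion ξ X n α).frontier_subset hx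
  obtain ⟨u, s, u₀, hu₀, hu, hs, hH⟩ := exists_tendsto_halfspaces_of_mem_frontier hx
  set P : Set (EuclideanSpace ℝ (Fin d)) := {p ∈ X '' (Finset.range n) | ⟪p - x, u₀⟫ = 0}
  suffices hxP : x ∈ affineSpan ℝ P by
    obtain ⟨T, hTP, hT, hTd, hxT⟩ := exists_finset_card_le_mem_affineSpan
      (((Finset.finite_toSet _).image X).subset (sep_subset _ _)) hu₀ (fun p hp => hp.2) hxP
    exact mem_biUnion (show _ ∧ _ from ⟨hTP.trans (sep_subset _ _), hT, hTd⟩) hxT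
  by_contra hxP
  obtain ⟨v, hv⟩ := exists_forall_inner_sub_eq_neg_one hxP
  -- Tilting the normals by a small multiple of `v` preserves the sides of the sample points
  -- off the limit hyperplane, while moving the points on it by a common amount.
  have hoff : ∀ᶠ δ : ℝ in 𝓝[>] 0, ∀ i ∈ Finset.range n, ⟪X i - x, u₀⟫ ≠ 0 →
      0 < (⟪X i - x, u₀ + δ • v⟫ + δ) * ⟪X i - x, u₀⟫ := by
    refine nhdsWithin_le_nhds ((Filter.eventually_all_finset _).2 fun i _ => ?_)
    by_cases hi : ⟪X i - x, u₀⟫ = 0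
    · simp [hi]
    have hcont : Continuous fun δ : ℝ =>
        (⟪X i - x, u₀ + δ • v⟫ + δ) * ⟪X i - x, u₀⟫ := by fun_prop
    filter_upwards [(hcont.tendsto 0).eventually_const_lt (u := 0)
      (by simpa using mul_self_pos.2 hi)] with δ hδ _ using hδ
  have hne : ∀ᶠ δ : ℝ in 𝓝[>] 0, u₀ + δ • v ≠ 0 := by
    have hcont : Continuous fun δ : ℝ => u₀ + δ • v := by fun_prop
    exact nhdsWithin_le_nhds (hcont.continuousAt.eventually_ne (by simpa using hu₀))
  obtain ⟨δ, hδoff, hδne, hδ⟩ := (hoff.and (hne.and self_mem_nhdsWithin)).exists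
  have hw : Tendsto (fun k => u k + δ • v) atTop (𝓝 (u₀ + δ • v)) := hu.add_const _
  have hsame : ∀ᶠ k in atTop, ∀ i ∈ Finset.range n, ⟪X i - x, u₀⟫ ≠ 0 →
      0 < (⟪X i - x, u k + δ • v⟫ + δ - s k) * (⟪X i - x, u k⟫ - s k) := by
    refine (Filter.eventually_all_finset _).2 fun i hi => ?_
    by_cases hi0 : ⟪X i - x, u₀⟫ = 0
    · simp [hi0]
    have hlim := ((((tendsto_const_nhds (x := X i - x)).inner hw).add_const δ).sub hs).mul
      (((tendsto_const_nhds (x := X i - x)).inner hu).sub hs)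
    filter_upwards [hlim.eventually_const_lt (u := 0)
      (by simpa only [sub_zero] using hδoff i hi hi0)] with k hk _ using hk
  obtain ⟨k, hksame, hkne, hks⟩ :=
    (hsame.and ((hw.eventually_ne hδne).and (hs.eventually_lt_const hδ))).exists
  have hset : {z | ⟪z - x, u k + δ • v⟫ ≤ s k - δ} =
      {z | ⟪z, u k + δ • v⟫ ≤ s k - δ + ⟪x, u k + δ • v⟫} := by
    ext z
    rw [mem_ofPred_eq, mem_ofPred_eq, inner_sub_left, sub_le_iff_le_add]
  have hmeas : empMeas ξ X n {z | ⟪z - x, u k⟫ ≤ s k} =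
      empMeas ξ X n {z | ⟪z - x, u k + δ • v⟫ ≤ s k - δ} := by
    refine empMeas_congr ξ fun i hi => ?_
    rw [mem_ofPred_eq, mem_ofPred_eq]
    by_cases hi0 : ⟪X i - x, u₀⟫ = 0
    · have hvi : ⟪X i - x, v⟫ = -1 :=
        hv _ ⟨mem_image_of_mem X (Finset.mem_coe.2 (Finset.mem_range.2 hi)), hi0⟩
      rw [inner_add_right, inner_smul_right, hvi, mul_neg_one, ← sub_eq_add_neg,
        sub_le_sub_iff_right]
    · rcases mul_pos_iff.1 (hksame i (Finset.mem_range.2 hi) hi0) with h | h <;>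
        constructor <;> intro <;> linarith
  have hxH : x ∈ {z | ⟪z - x, u k + δ • v⟫ ≤ s k - δ} :=
    hxR _ ⟨hset ▸ IsHalfspace.of_ne_zero hkne _, hmeas ▸ hH k⟩
  rw [mem_ofPred_eq, sub_self, inner_zero_left] at hxH
  linarith

end
end

section
/- Let I₁ and I₂ be finite subsets of ℝ^d, and let A be the intersection of all closed halfspaces which contain I₁ and do not intersect I₂. Then either A = ℝ^d, or the topological boundary of A is contained in the union of all affine subspaces generated by i-tuples of points from I₁ ∪ I₂ with i = 1, …, d. -/
open MeasureTheory Filter Set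
open scoped RealInnerProductSpace ENNReal Topology

noncomputable section

open Finset in
/-- Carathéodory's theorem for conic combinations. -/
theorem exists_linearIndepOn_conic_combination {ι V : Type*} [AddCommGroup V] [Module ℝ V]
    (v : ι → V) (s : Finset ι) (c : ι → ℝ) (hc : ∀ i ∈ s, 0 ≤ c i) :
    ∃ t ⊆ s, LinearIndepOn ℝ v (t : Set ι) ∧ ∃ c' : ι → ℝ, (∀ i ∈ t, 0 < c' i) ∧
      ∑ i ∈ t, c' i • v i = ∑ i ∈ s, c i • v i := by
  classical
  induction s using Finset.strongInduction generalizing c with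
  | H s ih =>
  by_cases hzero : ∃ i ∈ s, c i = 0
  · obtain ⟨i, hi, hci⟩ := hzero
    obtain ⟨t, hts, ht, c', hc', hsum⟩ := ih (s.erase i) (erase_ssubset hi) c
      fun j hj => hc j (mem_of_mem_erase hj)
    refine ⟨t, hts.trans (erase_subset _ _), ht, c', hc', ?_⟩
    rw [hsum, ← add_sum_erase s _ hi, hci, zero_smul, zero_add]
  push Not at hzero
  have hpos : ∀ i ∈ s, 0 < c i := fun i hi => (hc i hi).lt_of_ne' (hzero i hi)
  by_cases hli : LinearIndepOn ℝ v (s : Set ι)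
  · exact ⟨s, subset_rfl, hli, c, hpos, rfl⟩
  obtain ⟨g, hg, i₀, hi₀, hgi₀⟩ : ∃ g : ι → ℝ, ∑ i ∈ s, g i • v i = 0 ∧ ∃ i ∈ s, 0 < g i := by
    obtain ⟨g, hg, i, hi, hgi⟩ := not_linearIndepOn_finset_iff.1 hli
    rcases hgi.lt_or_gt with h | h
    · exact ⟨-g, by simp [hg], i, hi, by simpa using h⟩
    · exact ⟨g, hg, i, hi, h⟩
  obtain ⟨j, hj, hmin⟩ := exists_min_image (s.filter (0 < g ·)) (fun i => c i / g i)
    ⟨i₀, by simp [hi₀, hgi₀]⟩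
  rw [mem_filter] at hj
  have hr : 0 ≤ c j / g j := div_nonneg (hc j hj.1) hj.2.le
  have hnonneg : ∀ i ∈ s, 0 ≤ c i - c j / g j * g i := by
    intro i hi
    rcases le_or_gt (g i) 0 with h | h
    · nlinarith [hc i hi, mul_nonneg hr (neg_nonneg.2 h)]
    · have := (le_div_iff₀ h).1 (hmin i (by simp [hi, h]))
      linarith
  obtain ⟨t, hts, ht, c', hc', hsum⟩ := ih (s.erase j) (erase_ssubset hj.1)
    (fun i => c i - c j / g j * g i) fun i hi => hnonneg i (mem_of_mem_erase hi)
  refine ⟨t, hts.trans (erase_subset _ _), ht, c', hc', ?_⟩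
  have hj0 : c j - c j / g j * g j = 0 := by rw [div_mul_cancel₀ _ hj.2.ne', sub_self]
  calc _ = ∑ i ∈ s, (c i - c j / g j * g i) • v i := by
        rw [hsum, ← add_sum_erase s _ hj.1, hj0, zero_smul, zero_add]
    _ = _ := by
        simp only [sub_smul, sum_sub_distrib, mul_smul, ← smul_sum, hg, smul_zero, sub_zero]

/-- The positive combinations of a spanning linearly independent family form a neighbourhood of
each of their points. -/
theorem eventually_exists_pos_combination {ι V : Type*} [NormedAddCommGroup V] [NormedSpace ℝ V]
    [FiniteDimensional ℝ V] {v : ι → V} {t : Finset ι} (ht : LinearIndepOn ℝ v (t : Set ι))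
    (hcard : t.card = Module.finrank ℝ V) {c : ι → ℝ} (hc : ∀ i ∈ t, 0 < c i) :
    ∀ᶠ x in 𝓝 (∑ i ∈ t, c i • v i),
      ∃ c' : ι → ℝ, (∀ i ∈ t, 0 < c' i) ∧ ∑ i ∈ t, c' i • v i = x := by
  classical
  have hspan : ⊤ ≤ Submodule.span ℝ (Set.range fun i : (t : Set ι) => v i) := by
    rw [LinearIndependent.span_eq_top_of_card_eq_finrank' ht (by simpa using hcard)]
  let b := Module.Basis.mk ht hspan
  have hb : ∀ i : (t : Set ι), b i = v i := fun i => Module.Basis.mk_apply ht hspan i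
  have hcoord : ∀ i : (t : Set ι), b.repr (∑ j ∈ t, c j • v j) i = c i := by
    intro i
    have : ∑ j ∈ t, c j • v j = ∑ j : (t : Set ι), c j • b j := by
      simp only [hb]
      exact (Finset.sum_coe_sort t fun j => c j • v j).symm
    rw [this, b.repr_sum_self]
  have hev : ∀ᶠ x in 𝓝 (∑ i ∈ t, c i • v i), ∀ i : (t : Set ι), 0 < b.coord i x := by
    refine Filter.eventually_all.2 fun i => ?_
    refine ((b.coord i).continuous_of_finiteDimensional.tendsto _).eventually_const_lt ?_
    rw [b.coord_apply, hcoord]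
    exact hc i i.2
  filter_upwards [hev] with x hx
  refine ⟨fun i => if h : i ∈ (t : Set ι) then b.coord ⟨i, h⟩ x else 0, fun i hi => ?_, ?_⟩
  · simpa [hi] using hx ⟨i, hi⟩
  · rw [← Finset.sum_coe_sort t]
    conv_rhs => rw [← b.sum_repr x]
    exact Finset.sum_congr rfl fun i _ => by simp [hb]

/-- Disjoint convex hulls of finite sets can be separated by a closed halfspace. -/
theorem exists_isHalfspace_of_disjoint_convexHull {d : ℕ}
    {I J : Set (EuclideanSpace ℝ (Fin d))} (hI : I.Finite) (hJ : J.Finite) (hJ' : J.Nonempty)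
    {u₀ : EuclideanSpace ℝ (Fin d)} (hu₀ : ‖u₀‖ = 1)
    (hdisj : Disjoint (convexHull ℝ I) (convexHull ℝ J)) :
    ∃ H, IsHalfspace H ∧ I ⊆ H ∧ Disjoint H J := by
  rcases I.eq_empty_or_nonempty with rfl | ⟨x, hx⟩
  · obtain ⟨t, ht⟩ := (hJ.image fun z => ⟪z, u₀⟫).bddBelow
    refine ⟨_, ⟨u₀, t - 1, hu₀, rfl⟩, Set.empty_subset _, Set.disjoint_right.2 fun z hz h => ?_⟩
    have := ht (Set.mem_image_of_mem _ hz)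
    simp only [Set.mem_ofPred_eq] at h
    linarith
  obtain ⟨f, a, b, hfa, hab, hfb⟩ := geometric_hahn_banach_compact_closed (convex_convexHull ℝ I)
    (hI.isCompact_convexHull ℝ) (convex_convexHull ℝ J) (hJ.isClosed_convexHull ℝ) hdisj
  let w := (InnerProductSpace.toDual ℝ (EuclideanSpace ℝ (Fin d))).symm f
  have hw : ∀ z, ⟪z, w⟫ = f z := fun z => by
    rw [real_inner_comm, InnerProductSpace.toDual_symm_apply]
  have hw0 : w ≠ 0 := by
    intro h
    obtain ⟨y, hy⟩ := hJ'
    have h1 := hfa x (subset_convexHull ℝ _ hx)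
    have h2 := hfb y (subset_convexHull ℝ _ hy)
    rw [← hw, h, inner_zero_right] at h1 h2
    linarith
  have hn : 0 < ‖w‖ := norm_pos_iff.2 hw0
  have hiff : ∀ z, ⟪z, ‖w‖⁻¹ • w⟫ ≤ ‖w‖⁻¹ * a ↔ f z ≤ a := fun z => by
    rw [inner_smul_right, hw, mul_le_mul_iff_right₀ (inv_pos.2 hn)]
  refine ⟨_, ⟨‖w‖⁻¹ • w, ‖w‖⁻¹ * a, ?_, rfl⟩, fun z hz => ?_, Set.disjoint_right.2 fun z hz h => ?_⟩
  · rw [norm_smul, norm_inv, norm_norm, inv_mul_cancel₀ hn.ne']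
  · exact (hiff z).2 (hfa z (subset_convexHull ℝ _ hz)).le
  · have := hfb z (subset_convexHull ℝ _ hz)
    have := (hiff z).1 h
    linarith

open Finset in
/-- If the convex hull of `S ∪ {z}` meets that of `R` but the convex hull of `S` does not, then
`z` is an affine combination with nonnegative weights on `R` and nonpositive weights on `S`. -/
theorem exists_weights_of_not_disjoint_convexHull_insert {E : Type*} [AddCommGroup E] [Module ℝ E]
    [DecidableEq E] {R S : Finset E} {z : E}
    (hRS : Disjoint (convexHull ℝ (R : Set E)) (convexHull ℝ (S : Set E)))
    (hz : ¬ Disjoint (convexHull ℝ (R : Set E)) (convexHull ℝ (insert z (S : Set E)))) :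
    ∃ a b : E → ℝ, (∀ x ∈ R, 0 ≤ a x) ∧ (∀ y ∈ S, 0 ≤ b y) ∧
      ∑ x ∈ R, a x - ∑ y ∈ S, b y = 1 ∧ ∑ x ∈ R, a x • x - ∑ y ∈ S, b y • y = z := by
  have hzS : z ∉ S := by
    intro h
    rw [Set.insert_eq_of_mem (mem_coe.2 h)] at hz
    exact hz hRS
  obtain ⟨p, hpR, hpS⟩ := Set.not_disjoint_iff.1 hz
  rw [← coe_insert] at hpS
  obtain ⟨a, ha, ha1, hap⟩ := Finset.mem_convexHull'.1 hpR
  obtain ⟨b, hb, hb1, hbp⟩ := Finset.mem_convexHull'.1 hpS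
  rw [sum_insert hzS] at hb1 hbp
  have hbz : 0 < b z := by
    refine (hb z (mem_insert_self _ _)).lt_of_ne' fun h => ?_
    rw [h, zero_add] at hb1
    rw [h, zero_smul, zero_add] at hbp
    exact Set.disjoint_left.1 hRS hpR
      (Finset.mem_convexHull'.2 ⟨b, fun y hy => hb y (mem_insert_of_mem hy), hb1, hbp⟩)
  refine ⟨fun x => (b z)⁻¹ * a x, fun y => (b z)⁻¹ * b y,
    fun x hx => mul_nonneg (inv_pos.2 hbz).le (ha x hx),
    fun y hy => mul_nonneg (inv_pos.2 hbz).le (hb y (mem_insert_of_mem hy)), ?_, ?_⟩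
  · rw [← mul_sum, ← mul_sum, ← mul_sub, ha1, ← eq_sub_of_add_eq hb1,
      inv_mul_cancel₀ hbz.ne']
  · simp only [mul_smul]
    rw [← smul_sum, ← smul_sum, ← smul_sub, hap, ← hbp, add_sub_cancel_right,
      inv_smul_smul₀ hbz.ne']

open Finset in
/-- A linear combination with weights summing to `1` lies in the affine span. -/
theorem sum_smul_mem_affineSpan_image {ι E : Type*} [AddCommGroup E] [Module ℝ E] {t : Finset ι}
    {p : ι → E} {c : ι → ℝ} (hc : ∑ i ∈ t, c i = 1) :
    ∑ i ∈ t, c i • p i ∈ affineSpan ℝ (p '' t) := by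
  rw [← affineCombination_eq_linear_combination _ _ _ hc]
  exact affineCombination_mem_affineSpan_image hc (fun i hi hi' => (hi' hi).elim) p

/-- The lift to `E × ℝ` of a point of the left copy of `E` at height `1`, and of the negative of a
point of the right copy at height `-1`. -/
def signedLift (E : Type*) [AddCommGroup E] : E ⊕ E → E × ℝ :=
  Sum.elim (fun x => (x, 1)) fun y => (-y, -1)

open Finset in
/-- A point whose lift is a conic combination of lifts of `R` and `S` lies in every closed
halfspace containing `R` and avoiding `S`. -/
theorem mem_sInter_isHalfspace_of_eq_sum_signedLift {d : ℕ}
    {R S : Finset (EuclideanSpace ℝ (Fin d))} {t : Finset (_ ⊕ _)} (ht : t ⊆ R.disjSum S)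
    {c : _ → ℝ} (hc : ∀ i ∈ t, 0 ≤ c i) {z : EuclideanSpace ℝ (Fin d)}
    (hz : ∑ i ∈ t, c i • signedLift _ i = (z, 1)) :
    z ∈ ⋂₀ {H | IsHalfspace H ∧ (R : Set _) ⊆ H ∧ Disjoint H (S : Set _)} := by
  rintro _ ⟨⟨u, τ, -, rfl⟩, hR, hS⟩
  let φ : EuclideanSpace ℝ (Fin d) × ℝ →ₗ[ℝ] ℝ :=
    (innerₛₗ ℝ u).coprod (LinearMap.lsmul ℝ ℝ (-τ))
  have hφ : ∀ x r, φ (x, r) = ⟪x, u⟫ - τ * r := fun x r => by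
    simp [φ, real_inner_comm, sub_eq_add_neg]
  have hle : ∀ i ∈ t, φ (signedLift _ i) ≤ 0 := by
    intro i hi
    rcases i with x | y
    · have := hR (mem_coe.2 (inl_mem_disjSum.1 (ht hi)))
      simp only [Set.mem_ofPred_eq] at this
      simp only [signedLift, Sum.elim_inl, hφ]
      linarith
    · have := Set.disjoint_right.1 hS (mem_coe.2 (inr_mem_disjSum.1 (ht hi)))
      simp only [Set.mem_ofPred_eq, not_le] at this
      simp only [signedLift, Sum.elim_inr, hφ, inner_neg_left]
      linarith
  have hsum : φ (z, 1) ≤ 0 := by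
    rw [← hz, map_sum]
    exact sum_nonpos fun i hi => by
      rw [map_smul, smul_eq_mul]
      exact mul_nonpos_of_nonneg_of_nonpos (hc i hi) (hle i hi)
  rw [hφ] at hsum
  simp only [Set.mem_ofPred_eq]
  linarith

/-- If `I₁` and `I₂` are finite sets in `ℝ^d` then the intersection `A` of all closed
halfspaces which contain `I₁` and do not intersect `I₂` is either `ℝ^d` or has boundary
contained in the union of all affine subspaces generated by `i`-tuples of points from
`I₁ ∪ I₂` with `i = 1, …, d`. -/
theorem frontier_inter_halfspaces_subset_affineSpans
    {d : ℕ} (I₁ I₂ : Set (EuclideanSpace ℝ (Fin d))) (hI₁ : I₁.Finite) (hI₂ : I₂.Finite) :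
    (⋂₀ {H | IsHalfspace H ∧ I₁ ⊆ H ∧ Disjoint H I₂} = Set.univ) ∨
    frontier (⋂₀ {H | IsHalfspace H ∧ I₁ ⊆ H ∧ Disjoint H I₂}) ⊆
      ⋃ T ∈ {T : Finset (EuclideanSpace ℝ (Fin d)) |
          (T : Set (EuclideanSpace ℝ (Fin d))) ⊆ I₁ ∪ I₂ ∧ 1 ≤ T.card ∧ T.card ≤ d},
        (affineSpan ℝ (T : Set (EuclideanSpace ℝ (Fin d))) :
          Set (EuclideanSpace ℝ (Fin d))) := by
  classical
  lift I₁ to Finset (EuclideanSpace ℝ (Fin d)) using hI₁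
  lift I₂ to Finset (EuclideanSpace ℝ (Fin d)) using hI₂
  rw [or_iff_not_imp_left]
  intro hA z hz
  obtain ⟨H, ⟨⟨u, τ, hu, hH⟩, hH₁, hH₂⟩⟩ : ∃ H : Set (EuclideanSpace ℝ (Fin d)),
      IsHalfspace H ∧ (I₁ : Set _) ⊆ H ∧ Disjoint H (I₂ : Set _) := by
    by_contra! h
    exact hA (Set.sInter_eq_univ.2 fun H hH => (h H hH.1 hH.2.1 hH.2.2).elim)
  have hdisj : Disjoint (convexHull ℝ (I₁ : Set (EuclideanSpace ℝ (Fin d))))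
      (convexHull ℝ (I₂ : Set _)) := by
    have hlin : IsLinearMap ℝ fun z : EuclideanSpace ℝ (Fin d) => ⟪z, u⟫ :=
      ⟨fun x y => inner_add_left x y u, fun r x => real_inner_smul_left x u r⟩
    subst hH
    refine Disjoint.mono (convexHull_min hH₁ (convex_halfSpace_le hlin τ))
      (convexHull_min (fun y hy => ?_) (convex_halfSpace_gt hlin τ)) ?_
    · simpa using Set.disjoint_right.1 hH₂ hy
    · exact Set.disjoint_left.2 fun x (hx : ⟪x, u⟫ ≤ τ) hx' => not_lt_of_ge hx hx'
  have hclosed : IsClosed (⋂₀ {H : Set (EuclideanSpace ℝ (Fin d)) |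
      IsHalfspace H ∧ (I₁ : Set _) ⊆ H ∧ Disjoint H (I₂ : Set _)}) := by
    refine isClosed_sInter ?_
    rintro _ ⟨⟨u, τ, -, rfl⟩, -, -⟩
    exact isClosed_le (by fun_prop) continuous_const
  rw [hclosed.frontier_eq] at hz
  have hmeet : ¬ Disjoint (convexHull ℝ (I₁ : Set (EuclideanSpace ℝ (Fin d))))
      (convexHull ℝ (insert z (I₂ : Set _))) := by
    intro h
    obtain ⟨H', hH', hsub, hdis⟩ := exists_isHalfspace_of_disjoint_convexHull I₁.finite_toSet
      (I₂.finite_toSet.insert z) (Set.insert_nonempty _ _) hu h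
    exact Set.disjoint_left.1 hdis
      (hz.1 H' ⟨hH', hsub, hdis.mono_right (Set.subset_insert _ _)⟩) (Set.mem_insert _ _)
  obtain ⟨a, b, ha, hb, hab, habz⟩ := exists_weights_of_not_disjoint_convexHull_insert hdisj hmeet
  obtain ⟨t, hts, hli, c, hc, hsum⟩ := exists_linearIndepOn_conic_combination
    (signedLift (EuclideanSpace ℝ (Fin d))) (I₁.disjSum I₂) (Sum.elim a b) (by
      rintro (x | y) hi
      · exact ha x (Finset.inl_mem_disjSum.1 hi)
      · exact hb y (Finset.inr_mem_disjSum.1 hi))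
  have hzsum : ∑ i ∈ t, c i • signedLift _ i = (z, 1) := by
    rw [hsum, Finset.sum_disjSum]
    refine Prod.ext ?_ ?_
    · simp [signedLift, Prod.fst_sum, ← habz, sub_eq_add_neg]
    · simpa [signedLift, Prod.snd_sum, sub_eq_add_neg] using hab
  have hfinrank : Module.finrank ℝ (EuclideanSpace ℝ (Fin d) × ℝ) = d + 1 := by simp
  have hcard : t.card ≤ d := by
    have hle : t.card ≤ d + 1 := by
      simpa [hfinrank] using LinearIndependent.fintype_card_le_finrank hli
    by_contra hlt
    refine hz.2 (mem_interior_iff_mem_nhds.2 ?_)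
    have hev := eventually_exists_pos_combination hli (by omega) hc
    rw [hzsum] at hev
    have hcont : Continuous fun x : EuclideanSpace ℝ (Fin d) => (x, (1 : ℝ)) := by fun_prop
    filter_upwards [(hcont.tendsto z).eventually hev] with x ⟨c', hc', hx⟩
    exact mem_sInter_isHalfspace_of_eq_sum_signedLift hts (fun i hi => (hc' i hi).le) hx
  have hne : t.Nonempty := by
    rw [Finset.nonempty_iff_ne_empty]
    rintro rfl
    simpa using congrArg Prod.snd hzsum
  let p : EuclideanSpace ℝ (Fin d) ⊕ EuclideanSpace ℝ (Fin d) → EuclideanSpace ℝ (Fin d) :=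
    Sum.elim id id
  let σ : EuclideanSpace ℝ (Fin d) ⊕ EuclideanSpace ℝ (Fin d) → ℝ :=
    Sum.elim (fun _ => 1) fun _ => -1
  have hlift : ∀ i, signedLift _ i = (σ i • p i, σ i) := by
    rintro (x | y) <;> simp [signedLift, p, σ]
  simp only [hlift] at hzsum
  refine Set.mem_iUnion₂.2 ⟨t.image p, ⟨?_, (hne.image p).card_pos,
    Finset.card_image_le.trans hcard⟩, ?_⟩
  · intro x hx
    obtain ⟨i, hi, rfl⟩ := Finset.mem_image.1 (Finset.mem_coe.1 hx)
    rcases i with x | y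
    · exact Or.inl (Finset.inl_mem_disjSum.1 (hts hi))
    · exact Or.inr (Finset.inr_mem_disjSum.1 (hts hi))
  · have h1 : ∑ i ∈ t, c i * σ i = 1 := by
      simpa [Prod.snd_sum] using congrArg Prod.snd hzsum
    have h2 : ∑ i ∈ t, (c i * σ i) • p i = z := by
      simpa [Prod.fst_sum, mul_smul] using congrArg Prod.fst hzsum
    rw [Finset.coe_image, ← h2]
    exact sum_smul_mem_affineSpan_image h1
end
end

section
/- Assume (C3) and (C4) and let α ∈ (0, α_max). Define ϖ₊(x,r) = sup_{y ∈ B_r(x)} (D(y) − D(x)) and ϖ₋(x,r) = inf_{y ∈ B_r(x)} (D(y) − D(x)), where B_r(x) is the closed Euclidean ball of radius r around x. Then there is an open neighbourhood 𝒢(α) of ∂R(α) such that sup_{x ∈ 𝒢(α)} |ϖ₊(x,r)/r − T_{x,u_x}μ| → 0 and sup_{x ∈ 𝒢(α)} |ϖ₋(x,r)/r + T_{x,u_x}μ| → 0 as r ↓ 0, where u_x = ∇D(x)/‖∇D(x)‖. -/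
open MeasureTheory Filter Set
open scoped RealInnerProductSpace ENNReal Topology

noncomputable section

/-- The halfspace (Tukey) depth of a point `x` with respect to `μ`. -/
def halfspaceDepth {d : ℕ} (μ : Measure (EuclideanSpace ℝ (Fin d)))
    (x : EuclideanSpace ℝ (Fin d)) : ℝ :=
  sInf {r | ∃ H, IsHalfspace H ∧ x ∈ H ∧ r = (μ H).toReal}

/-- The depth trimmed region at level `α`. -/
def trimmedRegion {d : ℕ} (μ : Measure (EuclideanSpace ℝ (Fin d))) (α : ℝ) :
    Set (EuclideanSpace ℝ (Fin d)) :=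
  {x | α ≤ halfspaceDepth μ x}

/-- The maximal depth `α_max`. -/
def depthMax {d : ℕ} (μ : Measure (EuclideanSpace ℝ (Fin d))) : ℝ :=
  ⨆ x, halfspaceDepth μ x

/-- Condition (C3): the depth function is continuously differentiable in a neighbourhood of
`∂R(α)` with non-vanishing gradient on `∂R(α)`. -/
def CondC3 {d : ℕ} (μ : Measure (EuclideanSpace ℝ (Fin d))) (α : ℝ) : Prop :=
  (∃ U : Set (EuclideanSpace ℝ (Fin d)), IsOpen U ∧
    frontier (trimmedRegion μ α) ⊆ U ∧ ContDiffOn ℝ 1 (halfspaceDepth μ) U) ∧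
  ∀ x ∈ frontier (trimmedRegion μ α), gradient (halfspaceDepth μ) x ≠ 0

/-- Condition (C4): for every unit vector `u` the projection of `μ` on the direction `u`
has density `f u` which is jointly continuous and positive strictly between the essential
bounds of the support of the projection. -/
def CondC4 {d : ℕ} (μ : Measure (EuclideanSpace ℝ (Fin d)))
    (f : EuclideanSpace ℝ (Fin d) → ℝ → ℝ) : Prop :=
  (∀ u : EuclideanSpace ℝ (Fin d), ‖u‖ = 1 →
    μ.map (fun z => ⟪z, u⟫) =
      (volume : Measure ℝ).withDensity (fun t => ENNReal.ofReal (f u t))) ∧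
  ContinuousOn (fun p : EuclideanSpace ℝ (Fin d) × ℝ => f p.1 p.2)
    ((Metric.sphere (0 : EuclideanSpace ℝ (Fin d)) 1) ×ˢ (Set.univ : Set ℝ)) ∧
  (∀ u : EuclideanSpace ℝ (Fin d), ‖u‖ = 1 → ∀ t : ℝ,
    0 < μ.map (fun z => ⟪z, u⟫) (Set.Iio t) →
    0 < μ.map (fun z => ⟪z, u⟫) (Set.Ioi t) → 0 < f u t)

/-- The outer unit normal `u_x = ∇D(x)/‖∇D(x)‖` of the minimal halfspace at `x`. -/
def outerNormal {d : ℕ} (μ : Measure (EuclideanSpace ℝ (Fin d)))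
    (x : EuclideanSpace ℝ (Fin d)) : EuclideanSpace ℝ (Fin d) :=
  ‖gradient (halfspaceDepth μ) x‖⁻¹ • gradient (halfspaceDepth μ) x

/-- The Radon-transform type quantity `T_{x,u}μ = f_u(⟨x,u⟩)`. -/
def radonT {d : ℕ} (f : EuclideanSpace ℝ (Fin d) → ℝ → ℝ)
    (x u : EuclideanSpace ℝ (Fin d)) : ℝ :=
  f u ⟪x, u⟫

/-- The moduli `ϖ₊(x,r) = sup_{y ∈ B_r(x)} (D(y) − D(x))`. -/
def varpiPlus {d : ℕ} (μ : Measure (EuclideanSpace ℝ (Fin d)))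
    (x : EuclideanSpace ℝ (Fin d)) (r : ℝ) : ℝ :=
  ⨆ y : Metric.closedBall x r, (halfspaceDepth μ y.1 - halfspaceDepth μ x)

/-- The moduli `ϖ₋(x,r) = inf_{y ∈ B_r(x)} (D(y) − D(x))`. -/
def varpiMinus {d : ℕ} (μ : Measure (EuclideanSpace ℝ (Fin d)))
    (x : EuclideanSpace ℝ (Fin d)) (r : ℝ) : ℝ :=
  ⨅ y : Metric.closedBall x r, (halfspaceDepth μ y.1 - halfspaceDepth μ x)

theorem halfspaceDepth_le {d : ℕ} (μ : Measure (EuclideanSpace ℝ (Fin d)))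
    {u x : EuclideanSpace ℝ (Fin d)} {t : ℝ} (hu : ‖u‖ = 1) (hx : ⟪x, u⟫ ≤ t) :
    halfspaceDepth μ x ≤ μ.real {z | ⟪z, u⟫ ≤ t} := by
  refine csInf_le ⟨0, ?_⟩ ⟨_, ⟨u, t, hu, rfl⟩, hx, rfl⟩
  rintro _ ⟨H, -, -, rfl⟩
  exact ENNReal.toReal_nonneg

theorem isBounded_trimmedRegion {d : ℕ} (μ : Measure (EuclideanSpace ℝ (Fin d)))
    [IsProbabilityMeasure μ] {α : ℝ} (hα : 0 < α) :
    Bornology.IsBounded (trimmedRegion μ α) := by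
  have htight := tendsto_measure_compl_closedBall_of_isTightMeasureSet
    (isTightMeasureSet_singleton (μ := μ)) 0
  simp only [mem_singleton_iff, iSup_iSup_eq_left] at htight
  obtain ⟨R, hR0, hR⟩ := ((eventually_ge_atTop (0 : ℝ)).and
    (htight.eventually_lt_const (ENNReal.ofReal_pos.2 hα))).exists
  refine (Metric.isBounded_closedBall (x := 0) (r := R)).subset fun x hx => ?_
  by_contra hxR
  simp only [Metric.mem_closedBall, dist_zero_right, not_le] at hxR
  have hx0 : ‖x‖ ≠ 0 := (hR0.trans_lt hxR).ne'
  have hu : ‖-(‖x‖⁻¹ • x)‖ = 1 := by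
    rw [norm_neg, norm_smul, norm_inv, norm_norm, inv_mul_cancel₀ hx0]
  have hxu : ⟪x, -(‖x‖⁻¹ • x)⟫ = -‖x‖ := by
    rw [inner_neg_right, real_inner_smul_right, real_inner_self_eq_norm_sq]
    field_simp
  have hsub : {z : EuclideanSpace ℝ (Fin d) | ⟪z, -(‖x‖⁻¹ • x)⟫ ≤ -‖x‖} ⊆
      (Metric.closedBall 0 R)ᶜ := by
    intro z hz
    have h := neg_le_of_abs_le (abs_real_inner_le_norm z (-(‖x‖⁻¹ • x)))
    rw [hu, mul_one] at h
    simp only [mem_ofPred_eq] at hz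
    simp only [mem_compl_iff, Metric.mem_closedBall, dist_zero_right, not_le]
    linarith
  have hlt : μ.real {z | ⟪z, -(‖x‖⁻¹ • x)⟫ ≤ -‖x‖} < α :=
    (ENNReal.toReal_lt_of_lt_ofReal ((measure_mono hsub).trans_lt hR))
  exact absurd ((show α ≤ _ from hx).trans (halfspaceDepth_le μ hu hxu.le)) hlt.not_ge

/-- If hyperplanes are null sets, the infimum in the definition of the depth is attained. -/
theorem exists_minimal_halfspace {d : ℕ} (μ : Measure (EuclideanSpace ℝ (Fin d)))
    [IsFiniteMeasure μ]
    (hnull : ∀ u : EuclideanSpace ℝ (Fin d), ‖u‖ = 1 → ∀ t : ℝ, μ {z | ⟪z, u⟫ = t} = 0)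
    (hne : (Metric.sphere (0 : EuclideanSpace ℝ (Fin d)) 1).Nonempty)
    (x : EuclideanSpace ℝ (Fin d)) :
    ∃ u : EuclideanSpace ℝ (Fin d), ‖u‖ = 1 ∧
      halfspaceDepth μ x = μ.real {z | ⟪z, u⟫ ≤ ⟪x, u⟫} := by
  have hmeas (u : EuclideanSpace ℝ (Fin d)) (t : ℝ) : MeasurableSet {z | ⟪z, u⟫ ≤ t} :=
    measurableSet_le (by fun_prop) measurable_const
  have hcont : ContinuousOn (fun u => μ.real {z | ⟪z, u⟫ ≤ ⟪x, u⟫})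
      (Metric.sphere (0 : EuclideanSpace ℝ (Fin d)) 1) := by
    intro u hu
    refine (ENNReal.tendsto_toReal (measure_ne_top _ _)).comp
      (tendsto_measure_of_ae_tendsto_indicator _ (hmeas u _) (fun v => hmeas v _)
        MeasurableSet.univ (measure_ne_top _ _) (.of_forall fun _ => subset_univ _) ?_)
    have hae : ∀ᵐ z ∂μ, ⟪z, u⟫ ≠ ⟪x, u⟫ := by
      rw [ae_iff]
      simpa using hnull u (by simpa using hu) ⟪x, u⟫
    filter_upwards [hae] with z hz
    have hz' : Tendsto (fun v => ⟪z, v⟫) (𝓝[Metric.sphere 0 1] u) (𝓝 ⟪z, u⟫) :=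
      (Continuous.tendsto (by fun_prop) u).mono_left nhdsWithin_le_nhds
    have hx' : Tendsto (fun v => ⟪x, v⟫) (𝓝[Metric.sphere 0 1] u) (𝓝 ⟪x, u⟫) :=
      (Continuous.tendsto (by fun_prop) u).mono_left nhdsWithin_le_nhds
    rcases hz.lt_or_gt with h | h
    · filter_upwards [hz'.eventually_lt hx' h] with v hv
      exact iff_of_true hv.le h.le
    · filter_upwards [hx'.eventually_lt hz' h] with v hv
      exact iff_of_false hv.not_ge h.not_ge
  obtain ⟨u, hu, hmin⟩ := (isCompact_sphere _ _).exists_isMinOn hne hcont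
  have hu1 : ‖u‖ = 1 := by simpa using hu
  refine ⟨u, hu1, (halfspaceDepth_le μ hu1 le_rfl).antisymm ?_⟩
  refine le_csInf ⟨_, _, ⟨u, _, hu1, rfl⟩, le_refl ⟪x, u⟫, rfl⟩ ?_
  rintro _ ⟨_, ⟨v, t, hv, rfl⟩, hxt, rfl⟩
  refine (isMinOn_iff.1 hmin v (by simpa using hv)).trans (measureReal_mono fun z hz => ?_)
  exact le_trans (show ⟪z, v⟫ ≤ ⟪x, v⟫ from hz) hxt

/-- The distribution function of a finite measure with continuous density `g⁺` is
differentiable with derivative `g⁺`. -/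
theorem hasDerivAt_measureReal_Iic {ν : Measure ℝ} [IsFiniteMeasure ν] {g : ℝ → ℝ}
    (hg : Continuous g) (hν : ν = volume.withDensity fun t => ENNReal.ofReal (g t)) (t : ℝ) :
    HasDerivAt (fun s => ν.real (Iic s)) (max (g t) 0) t := by
  have hcont : Continuous fun s => max (g s) 0 := by fun_prop
  have hnonneg : 0 ≤ fun s => max (g s) 0 := fun s => le_max_right _ _
  have hofReal (s : ℝ) : ENNReal.ofReal (max (g s) 0) = ENNReal.ofReal (g s) := by
    simp [ENNReal.ofReal, Real.toNNReal]
  have hint : Integrable (fun s => max (g s) 0) := by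
    refine ⟨hcont.aestronglyMeasurable, ?_⟩
    rw [hasFiniteIntegral_iff_ofReal (.of_forall hnonneg)]
    simp only [hofReal]
    have h := measure_lt_top ν univ
    rwa [hν, withDensity_apply _ MeasurableSet.univ, setLIntegral_univ] at h
  have hcdf (s : ℝ) : ν.real (Iic s) = ∫ w in Iic s, max (g w) 0 := by
    rw [integral_eq_lintegral_of_nonneg_ae (.of_forall hnonneg)
      hcont.aestronglyMeasurable]
    simp only [hofReal]
    rw [measureReal_def, hν, withDensity_apply _ measurableSet_Iic]
  have hsplit : (fun s => ν.real (Iic s)) =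
      fun s => (∫ w in t..s, max (g w) 0) + ν.real (Iic t) := by
    ext s
    rw [hcdf, hcdf, ← intervalIntegral.integral_Iic_sub_Iic hint.integrableOn hint.integrableOn,
      sub_add_cancel]
  rw [hsplit]
  exact (intervalIntegral.integral_hasDerivAt_right (hcont.intervalIntegrable _ _)
    hcont.aestronglyMeasurable.stronglyMeasurableAtFilter hcont.continuousAt).add_const _

theorem continuous_density {d : ℕ} {μ : Measure (EuclideanSpace ℝ (Fin d))}
    {f : EuclideanSpace ℝ (Fin d) → ℝ → ℝ} (hC4 : CondC4 μ f)
    {u : EuclideanSpace ℝ (Fin d)} (hu : ‖u‖ = 1) : Continuous (f u) :=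
  hC4.2.1.comp_continuous (Continuous.prodMk_right u) fun _ => ⟨by simpa using hu, mem_univ _⟩

theorem measureReal_map_inner_Iic {d : ℕ} (μ : Measure (EuclideanSpace ℝ (Fin d)))
    (u : EuclideanSpace ℝ (Fin d)) (t : ℝ) :
    (μ.map fun z => ⟪z, u⟫).real (Iic t) = μ.real {z | ⟪z, u⟫ ≤ t} :=
  map_measureReal_apply (by fun_prop) measurableSet_Iic

/-- The norm of a non-vanishing gradient of the depth is the density of the projection on
the outer normal. -/
theorem radonT_outerNormal_eq_norm_gradient {d : ℕ} {μ : Measure (EuclideanSpace ℝ (Fin d))}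
    [IsProbabilityMeasure μ] {f : EuclideanSpace ℝ (Fin d) → ℝ → ℝ} (hC4 : CondC4 μ f)
    {x : EuclideanSpace ℝ (Fin d)} (hx : DifferentiableAt ℝ (halfspaceDepth μ) x)
    (hgrad : gradient (halfspaceDepth μ) x ≠ 0) :
    radonT f x (outerNormal μ x) = ‖gradient (halfspaceDepth μ) x‖ := by
  have hnull : ∀ u : EuclideanSpace ℝ (Fin d), ‖u‖ = 1 → ∀ t : ℝ,
      μ {z | ⟪z, u⟫ = t} = 0 := by
    intro u hu t
    have h : (μ.map fun z => ⟪z, u⟫) {t} = 0 := by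
      rw [hC4.1 u hu]
      exact withDensity_absolutelyContinuous _ _ (measure_singleton t)
    rwa [Measure.map_apply (by fun_prop) (measurableSet_singleton t)] at h
  have hne : (Metric.sphere (0 : EuclideanSpace ℝ (Fin d)) 1).Nonempty :=
    ⟨outerNormal μ x, by
      simp [outerNormal, norm_smul, inv_mul_cancel₀ (norm_ne_zero_iff.2 hgrad)]⟩
  obtain ⟨u, hu, hmin⟩ := exists_minimal_halfspace μ hnull hne x
  have hF := hasDerivAt_measureReal_Iic (ν := μ.map fun z => ⟪z, u⟫)
    (continuous_density hC4 hu) (hC4.1 u hu) ⟪x, u⟫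
  simp only [measureReal_map_inner_Iic] at hF
  have hinner : HasFDerivAt (fun y : EuclideanSpace ℝ (Fin d) => ⟪y, u⟫) (innerSL ℝ u) x := by
    simpa [real_inner_comm] using (innerSL ℝ u).hasFDerivAt (x := x)
  have hlocal : IsLocalMin
      (fun y => μ.real {z | ⟪z, u⟫ ≤ ⟪y, u⟫} - halfspaceDepth μ y) x := by
    refine .of_forall fun y => ?_
    simp only [← hmin, sub_self]
    exact sub_nonneg.2 (halfspaceDepth_le μ hu le_rfl)
  have hcomp : HasFDerivAt (fun y => μ.real {z | ⟪z, u⟫ ≤ ⟪y, u⟫})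
      (max (f u ⟪x, u⟫) 0 • innerSL ℝ u) x :=
    HasDerivAt.comp_hasFDerivAt (h₂ := fun s => μ.real {z | ⟪z, u⟫ ≤ s}) x hF hinner
  have hzero := hlocal.hasFDerivAt_eq_zero (hcomp.fun_sub hx.hasFDerivAt)
  have hgrad_eq : gradient (halfspaceDepth μ) x = max (f u ⟪x, u⟫) 0 • u := by
    rw [gradient, ← sub_eq_zero.1 hzero, map_smul]
    congr 1
    exact (InnerProductSpace.toDual ℝ _).symm_apply_apply u
  have hpos : 0 < f u ⟪x, u⟫ := by
    by_contra! h
    rw [max_eq_right h, zero_smul] at hgrad_eq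
    exact hgrad hgrad_eq
  rw [max_eq_left hpos.le] at hgrad_eq
  have hnorm : ‖gradient (halfspaceDepth μ) x‖ = f u ⟪x, u⟫ := by
    rw [hgrad_eq, norm_smul, hu, mul_one, Real.norm_of_nonneg hpos.le]
  have hnormal : outerNormal μ x = u := by
    rw [outerNormal, hnorm, hgrad_eq, inv_smul_smul₀ hpos.ne']
  rw [radonT, hnormal, hnorm]

/-- If `φ` has slope `v` on the ball `B_r(x)` up to an error `ε`, then its largest increment
over the ball is `r ‖v‖` up to an error `ε r`. -/
theorem abs_iSup_closedBall_sub_norm_le {E : Type*} [NormedAddCommGroup E]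
    [InnerProductSpace ℝ E] {φ : E → ℝ} {x v : E} {r ε : ℝ} (hr : 0 < r) (hε : 0 ≤ ε)
    (h : ∀ y ∈ Metric.closedBall x r, |φ y - φ x - ⟪v, y - x⟫| ≤ ε * ‖y - x‖) :
    |(⨆ y : Metric.closedBall x r, (φ y.1 - φ x)) / r - ‖v‖| ≤ ε := by
  have hle (y : Metric.closedBall x r) : φ y.1 - φ x ≤ (‖v‖ + ε) * r := by
    have hyr : ‖y.1 - x‖ ≤ r := by
      rw [← dist_eq_norm]
      exact y.2
    have h₁ := le_of_abs_le (h y.1 y.2)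
    have h₂ := real_inner_le_norm v (y.1 - x)
    nlinarith [mul_le_mul_of_nonneg_left hyr hε, mul_le_mul_of_nonneg_left hyr (norm_nonneg v)]
  have : Nonempty (Metric.closedBall x r) := ⟨⟨x, Metric.mem_closedBall_self hr.le⟩⟩
  have hub := ciSup_le hle
  have hlb : (‖v‖ - ε) * r ≤ ⨆ y : Metric.closedBall x r, (φ y.1 - φ x) := by
    set w := (r * ‖v‖⁻¹) • v with hw
    have hwr : ‖w‖ ≤ r := by
      rw [hw, norm_smul, norm_mul, norm_inv, norm_norm, Real.norm_of_nonneg hr.le, mul_assoc]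
      exact mul_le_of_le_one_right hr.le (inv_mul_le_one)
    have hmem : x + w ∈ Metric.closedBall x r := by simpa using hwr
    have hvw : ⟪v, w⟫ = ‖v‖ * r := by
      rw [hw, real_inner_smul_right, real_inner_self_eq_norm_sq]
      by_cases hv : ‖v‖ = 0
      · simp [hv]
      · field_simp
    have h₁ := neg_le_of_abs_le (h _ hmem)
    rw [add_sub_cancel_left, hvw] at h₁
    refine le_trans ?_ (le_ciSup ⟨_, forall_mem_range.2 hle⟩ ⟨x + w, hmem⟩)
    nlinarith [mul_le_mul_of_nonneg_left hwr hε]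
  rw [abs_sub_le_iff, sub_le_iff_le_add', sub_le_comm, div_le_iff₀ hr, le_div_iff₀ hr]
  exact ⟨hub, hlb⟩

theorem abs_iInf_closedBall_add_norm_le {E : Type*} [NormedAddCommGroup E]
    [InnerProductSpace ℝ E] {φ : E → ℝ} {x v : E} {r ε : ℝ} (hr : 0 < r) (hε : 0 ≤ ε)
    (h : ∀ y ∈ Metric.closedBall x r, |φ y - φ x - ⟪v, y - x⟫| ≤ ε * ‖y - x‖) :
    |(⨅ y : Metric.closedBall x r, (φ y.1 - φ x)) / r + ‖v‖| ≤ ε := by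
  have hneg := abs_iSup_closedBall_sub_norm_le (φ := -φ) (v := -v) hr hε fun y hy => by
    rw [← abs_neg, inner_neg_left]
    convert h y hy using 2
    simp only [Pi.neg_apply]
    ring
  have hiInf : ⨅ y : Metric.closedBall x r, (φ y.1 - φ x) =
      -⨆ y : Metric.closedBall x r, ((-φ) y.1 - (-φ) x) := by
    rw [iInf, Real.sInf_def, iSup, ← image_neg_eq_neg, ← range_comp]
    congr 3
    ext y
    simp only [Function.comp_apply, Pi.neg_apply]
    ring
  rw [hiInf, ← abs_neg]
  convert hneg using 2
  rw [norm_neg]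
  ring

/-- A function that is continuously differentiable near a compact set is uniformly
differentiable near this set. -/
theorem exists_thickening_uniform_gradient {E : Type*} [NormedAddCommGroup E]
    [InnerProductSpace ℝ E] [ProperSpace E] {φ : E → ℝ} {K V : Set E}
    (hK : IsCompact K) (hV : IsOpen V) (hKV : K ⊆ V) (hφ : ContDiffOn ℝ 1 φ V) :
    ∃ δ > 0, Metric.thickening δ K ⊆ V ∧ ∀ ε > 0, ∀ᶠ r in 𝓝[>] (0 : ℝ),
      ∀ x ∈ Metric.thickening δ K, ∀ y ∈ Metric.closedBall x r,
        |φ y - φ x - ⟪gradient φ x, y - x⟫| ≤ ε * ‖y - x‖ := by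
  obtain ⟨δ, hδ, hδV⟩ := hK.exists_cthickening_subset_open hV hKV
  have hunif := hK.cthickening.uniformContinuousOn_of_continuous
    ((hφ.continuousOn_fderiv_of_isOpen hV le_rfl).mono hδV)
  refine ⟨δ / 2, half_pos hδ, fun x hx => hδV ?_, fun ε hε => ?_⟩
  · exact Metric.thickening_subset_cthickening_of_le (half_le_self hδ.le) K hx
  obtain ⟨η, hη, hηε⟩ := Metric.uniformContinuousOn_iff.1 hunif ε hε
  filter_upwards [Ioo_mem_nhdsGT (lt_min (half_pos hδ) hη)] with r hr x hx y hy
  have hball : Metric.closedBall x r ⊆ Metric.cthickening δ K := by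
    intro z hz
    obtain ⟨w, hw, hxw⟩ := Metric.mem_thickening_iff.1 hx
    refine Metric.mem_cthickening_of_dist_le z w δ K hw ?_
    have := dist_triangle z x w
    have := Metric.mem_closedBall.1 hz
    have := hr.2.trans_le (min_le_left _ _)
    linarith
  have hxmem := Metric.mem_closedBall_self (x := x) hr.1.le
  have hbound := (convex_closedBall x r).norm_image_sub_le_of_norm_fderiv_le' (𝕜 := ℝ) (f := φ)
    (φ := fderiv ℝ φ x) (C := ε)
    (fun z hz => (hφ.differentiableOn one_ne_zero).differentiableAt
      (hV.mem_nhds (hδV (hball hz))))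
    (fun z hz => ?_) hxmem hy
  · rwa [Real.norm_eq_abs, ← toDual_gradient, InnerProductSpace.toDual_apply_apply] at hbound
  · rw [← dist_eq_norm]
    exact (hηε z (hball hz) x (hball hxmem)
      ((Metric.mem_closedBall.1 hz).trans_lt (hr.2.trans_le (min_le_right _ _)))).le

theorem tendsto_iSup_abs_of_forall_eventually_le {ι X : Type*} {l : Filter ι} {F : ι → X → ℝ}
    (h : ∀ ε > 0, ∀ᶠ i in l, ∀ x, |F i x| ≤ ε) :
    Tendsto (fun i => ⨆ x, |F i x|) l (𝓝 0) := by
  refine Metric.tendsto_nhds.2 fun ε hε => ?_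
  filter_upwards [h (ε / 2) (half_pos hε)] with i hi
  rw [Real.dist_eq, sub_zero, abs_of_nonneg (Real.iSup_nonneg fun _ => abs_nonneg _)]
  exact (Real.iSup_le hi (half_pos hε).le).trans_lt (half_lt_self hε)

/-- Uniform differentiability of the depth function along the normal direction: on a
neighbourhood of `∂R(α)`, `ϖ₊(x,r)/r → T_{x,u_x}μ` and `ϖ₋(x,r)/r → −T_{x,u_x}μ`
uniformly as `r ↓ 0`. -/
theorem varpi_uniform_derivative
    {d : ℕ} (μ : Measure (EuclideanSpace ℝ (Fin d))) [IsProbabilityMeasure μ]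
    (f : EuclideanSpace ℝ (Fin d) → ℝ → ℝ)
    (α : ℝ) (hα0 : 0 < α) (hα : α < depthMax μ)
    (hC3 : CondC3 μ α) (hC4 : CondC4 μ f) :
    ∃ G : Set (EuclideanSpace ℝ (Fin d)), IsOpen G ∧ frontier (trimmedRegion μ α) ⊆ G ∧
      Tendsto (fun r : ℝ =>
          ⨆ x : G, |varpiPlus μ x.1 r / r - radonT f x.1 (outerNormal μ x.1)|)
        (nhdsWithin 0 (Set.Ioi 0)) (nhds 0) ∧
      Tendsto (fun r : ℝ =>
          ⨆ x : G, |varpiMinus μ x.1 r / r + radonT f x.1 (outerNormal μ x.1)|)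
        (nhdsWithin 0 (Set.Ioi 0)) (nhds 0) := by
  obtain ⟨⟨U, hU, hfU, hD⟩, hgrad⟩ := hC3
  set V := U ∩ fderiv ℝ (halfspaceDepth μ) ⁻¹' {0}ᶜ with hVdef
  have hmemV {x} : x ∈ V ↔ x ∈ U ∧ gradient (halfspaceDepth μ) x ≠ 0 := by
    simp [hVdef, gradient]
  have hV : IsOpen V :=
    (hD.continuousOn_fderiv_of_isOpen hU le_rfl).isOpen_inter_preimage hU
      isOpen_compl_singleton
  have hK : IsCompact (frontier (trimmedRegion μ α)) :=
    Metric.isCompact_of_isClosed_isBounded isClosed_frontier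
      ((isBounded_trimmedRegion μ hα0).closure.subset frontier_subset_closure)
  obtain ⟨δ, hδ, hδV, hunif⟩ := exists_thickening_uniform_gradient hK hV
    (fun x hx => hmemV.2 ⟨hfU hx, hgrad x hx⟩) (hD.mono inter_subset_left)
  have hT {x} (hx : x ∈ Metric.thickening δ (frontier (trimmedRegion μ α))) :
      radonT f x (outerNormal μ x) = ‖gradient (halfspaceDepth μ) x‖ := by
    obtain ⟨hxU, hx0⟩ := hmemV.1 (hδV hx)
    exact radonT_outerNormal_eq_norm_gradient hC4
      ((hD.differentiableOn one_ne_zero).differentiableAt (hU.mem_nhds hxU)) hx0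
  refine ⟨_, Metric.isOpen_thickening, Metric.self_subset_thickening hδ _, ?_, ?_⟩
  · refine tendsto_iSup_abs_of_forall_eventually_le fun ε hε => ?_
    filter_upwards [hunif ε hε, self_mem_nhdsWithin] with r hr hr0 x
    rw [hT x.2]
    exact abs_iSup_closedBall_sub_norm_le hr0 hε.le (hr x.1 x.2)
  · refine tendsto_iSup_abs_of_forall_eventually_le fun ε hε => ?_
    filter_upwards [hunif ε hε, self_mem_nhdsWithin] with r hr hr0 x
    rw [hT x.2]
    exact abs_iInf_closedBall_add_norm_le hr0 hε.le (hr x.1 x.2)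

end
end

section
/- Let K be a convex body in ℝ^d and δ > 0 such that the inner envelope K^{−δ} = {x : B_δ(x) ⊆ K} is nonempty. Then there exist constants c₁, c₂ > 0 depending only on K and δ such that for every pair of (d−1)-dimensional affine hyperplanes E₁, E₂ which both intersect K^{−δ}: ρ_H(K ∩ E₁, K ∩ E₂) ≤ c₁ ρ_H(E₁, E₂) and ‖C(K ∩ E₁) − C(K ∩ E₂)‖ ≤ c₂ ρ_H(E₁, E₂), where C(L) denotes the centroid of a (d−1)-dimensional convex set L, i.e. C(L) = (1/V_{d−1}(L)) ∫_L x dx with the integral taken with respect to (d−1)-dimensional Lebesgue measure on the affine span of L. -/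
open MeasureTheory Filter Set
open scoped RealInnerProductSpace ENNReal NNReal Topology

noncomputable section

/-- The inner `r`-envelope `K^{−r} = {x : B_r(x) ⊆ K}`. -/
def innerEnvelope {d : ℕ} (K : Set (EuclideanSpace ℝ (Fin d))) (r : ℝ) :
    Set (EuclideanSpace ℝ (Fin d)) :=
  {x | Metric.closedBall x r ⊆ K}

/-- The centroid of a `(d−1)`-dimensional convex set `L`, computed with respect to the
`(d−1)`-dimensional Hausdorff measure (which coincides with Lebesgue measure on the affine
span of `L`). -/
def centroid (d : ℕ) (L : Set (EuclideanSpace ℝ (Fin d))) : EuclideanSpace ℝ (Fin d) :=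
  ((μH[(d : ℝ) - 1] : Measure (EuclideanSpace ℝ (Fin d))) L).toReal⁻¹ •
    ∫ x in L, x ∂(μH[(d : ℝ) - 1] : Measure (EuclideanSpace ℝ (Fin d)))

section Hyperplanes

variable {E : Type*} [NormedAddCommGroup E] [InnerProductSpace ℝ E]

/-- The distance from a point to a hyperplane is at least the gap in the height function. -/
theorem ofReal_abs_inner_sub_le_infEDist {u : E} (hu : ‖u‖ = 1) (x : E) (t : ℝ) :
    ENNReal.ofReal |⟪x, u⟫ - t| ≤ Metric.infEDist x {z : E | ⟪z, u⟫ = t} := by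
  refine Metric.le_infEDist.2 fun y hy => ?_
  rw [edist_dist, dist_eq_norm]
  refine ENNReal.ofReal_le_ofReal ?_
  rw [← (hy : ⟪y, u⟫ = t), ← inner_sub_left]
  simpa [hu] using abs_real_inner_le_norm (x - y) u

/-- Parallel hyperplanes are at Hausdorff distance at least the difference of their heights. -/
theorem ofReal_abs_sub_le_hausdorffEDist {u : E} (hu : ‖u‖ = 1) (s t : ℝ) :
    ENNReal.ofReal |s - t| ≤
      Metric.hausdorffEDist {z : E | ⟪z, u⟫ = s} {z : E | ⟪z, u⟫ = t} := by
  have hx : ⟪s • u, u⟫ = s := by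
    rw [real_inner_smul_left, real_inner_self_eq_norm_sq, hu]; simp
  have h := ofReal_abs_inner_sub_le_infEDist hu (s • u) t
  rw [hx] at h
  exact h.trans (Metric.infEDist_le_hausdorffEDist_of_mem hx)

/-- Hyperplanes that are not parallel are at infinite Hausdorff distance. -/
theorem hausdorffEDist_hyperplane_eq_top {u v : E} (hu : ‖u‖ = 1) (hv : ‖v‖ = 1)
    (h₁ : v ≠ u) (h₂ : v ≠ -u) (s t : ℝ) :
    Metric.hausdorffEDist {z : E | ⟪z, u⟫ = s} {z : E | ⟪z, v⟫ = t} = ⊤ := by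
  set c : ℝ := ⟪u, v⟫ with hc
  have huu : ⟪u, u⟫ = (1 : ℝ) := by rw [real_inner_self_eq_norm_sq, hu]; simp
  have hvv : ⟪v, v⟫ = (1 : ℝ) := by rw [real_inner_self_eq_norm_sq, hv]; simp
  have hvu : ⟪v, u⟫ = c := real_inner_comm _ _
  have hc1 : c ≠ 1 := fun h => h₁ ((inner_eq_one_iff_of_norm_eq_one hu hv).1 h).symm
  have hc2 : c ≠ -1 := fun h => h₂ (by
    have := (inner_eq_one_iff_of_norm_eq_one (𝕜 := ℝ) (x := -u) (by simpa using hu) hv).1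
      (by rw [inner_neg_left, ← hc, h]; simp)
    exact this.symm)
  have hcc : 1 - c ^ 2 ≠ 0 := by
    intro h
    rcases sq_eq_sq_iff_eq_or_eq_neg.1 (by linarith : c ^ 2 = 1 ^ 2) with h | h
    · exact hc1 h
    · exact hc2 h
  refine ENNReal.eq_top_of_forall_nnreal_le fun r => ?_
  set a : ℝ := (t + r - s * c) / (1 - c ^ 2)
  have hx : ⟪s • u + a • (v - c • u), u⟫ = s := by
    simp only [inner_add_left, inner_sub_left, real_inner_smul_left, huu, hvu]; ring
  have hy : ⟪s • u + a • (v - c • u), v⟫ = t + r := by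
    simp only [inner_add_left, inner_sub_left, real_inner_smul_left, hvv, ← hc]
    have : a * (1 - c ^ 2) = t + r - s * c := div_mul_cancel₀ _ hcc
    linarith
  have h := ofReal_abs_inner_sub_le_infEDist hv (s • u + a • (v - c • u)) t
  rw [hy, add_sub_cancel_left, NNReal.abs_eq, ENNReal.ofReal_coe_nnreal] at h
  exact h.trans (Metric.infEDist_le_hausdorffEDist_of_mem hx)

/-- If a convex set contains a ball of radius `δ` centred at height `t`, some homothety with
centre in the set and ratio `δ / (|s - t| + δ)` maps its section at height `s` into its section
at height `t`. -/
theorem exists_homothety_image_section_subset {K : Set E} (hK : Convex ℝ K) {δ : ℝ} (hδ : 0 < δ)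
    {u p : E} (hu : ‖u‖ = 1) (hp : Metric.closedBall p δ ⊆ K) {t : ℝ} (hpt : ⟪p, u⟫ = t) (s : ℝ) :
    ∃ q ∈ K, AffineMap.homothety q (δ / (|s - t| + δ)) '' (K ∩ {z | ⟪z, u⟫ = s}) ⊆
      K ∩ {z | ⟪z, u⟫ = t} := by
  obtain ⟨σ, hσ, hσs⟩ : ∃ σ : ℝ, |σ| = 1 ∧ |s - t| * σ = t - s := by
    rcases le_total s t with h | h
    · exact ⟨1, by simp, by rw [abs_of_nonpos (by linarith)]; ring⟩
    · exact ⟨-1, by simp, by rw [abs_of_nonneg (by linarith)]; ring⟩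
  have hden : 0 < |s - t| + δ := by positivity
  set r := δ / (|s - t| + δ) with hr
  have hr0 : 0 ≤ r := by positivity
  have hr1 : r ≤ 1 := (div_le_one hden).2 (by linarith [abs_nonneg (s - t)])
  have hqK : p + (δ * σ) • u ∈ K := hp (by
    simp [Metric.mem_closedBall, dist_eq_norm, norm_smul, hu, hσ, abs_of_pos hδ])
  refine ⟨p + (δ * σ) • u, hqK, ?_⟩
  rintro _ ⟨x, ⟨hxK, hxs⟩, rfl⟩
  have hform : AffineMap.homothety (p + (δ * σ) • u) r x
      = r • x + (1 - r) • (p + (δ * σ) • u) := by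
    rw [AffineMap.homothety_apply]; simp only [vsub_eq_sub, vadd_eq_add]; module
  rw [hform]
  refine ⟨hK hxK hqK hr0 (by linarith) (by ring), ?_⟩
  have hxs' : ⟪x, u⟫ = s := hxs
  have huu : ⟪u, u⟫ = (1 : ℝ) := by rw [real_inner_self_eq_norm_sq, hu]; simp
  simp only [mem_ofPred_eq, inner_add_left, real_inner_smul_left, hxs', hpt, huu]
  have hrd : r * (|s - t| + δ) = δ := div_mul_cancel₀ _ hden.ne'
  have h1r : (1 - r) * δ = r * |s - t| := by linarith
  linear_combination σ * h1r + r * hσs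

end Hyperplanes

theorem one_sub_div_abs_add_le {δ : ℝ} (hδ : 0 < δ) (a : ℝ) :
    1 - δ / (|a| + δ) ≤ |a| / δ := by
  have : 0 < |a| + δ := by positivity
  rw [one_sub_div this.ne', add_sub_cancel_right]
  exact div_le_div_of_nonneg_left (abs_nonneg a) hδ (by linarith [abs_nonneg a])

/-- A homothety with ratio `r ≤ 1` centred in the ball of radius `R` about the origin moves the
points of that ball by at most `(1 - r) * (2 * R)`. -/
theorem norm_sub_homothety_le {E : Type*} [NormedAddCommGroup E] [NormedSpace ℝ E] {q x : E}
    {r R : ℝ} (hr : r ≤ 1) (hq : ‖q‖ ≤ R) (hx : ‖x‖ ≤ R) :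
    ‖x - AffineMap.homothety q r x‖ ≤ (1 - r) * (2 * R) := by
  have : x - AffineMap.homothety q r x = (1 - r) • (x - q) := by
    rw [AffineMap.homothety_apply]; simp only [vsub_eq_sub, vadd_eq_add]; module
  rw [this, norm_smul, Real.norm_of_nonneg (by linarith)]
  refine mul_le_mul_of_nonneg_left ?_ (by linarith)
  linarith [norm_sub_le x q]

section Average

variable {E : Type*} [NormedAddCommGroup E] [NormedSpace ℝ E] [MeasurableSpace E]

theorem integrableOn_id_of_norm_le {E : Type*} [NormedAddCommGroup E] [MeasurableSpace E]
    [BorelSpace E] [SecondCountableTopology E] {μ : Measure E} {A : Set E}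
    (hAm : MeasurableSet A) {R : ℝ} (hA : ∀ x ∈ A, ‖x‖ ≤ R) (hfin : μ A ≠ ∞) :
    IntegrableOn (fun x => x) A μ :=
  Measure.integrableOn_of_bounded (M := R) hfin measurable_id.aestronglyMeasurable
    ((ae_restrict_iff' hAm).2 (Eventually.of_forall hA))

/-- The average of the identity over a bounded set is bounded. -/
theorem norm_setAverage_id_le {μ : Measure E} {A : Set E} {R : ℝ} (hR : 0 ≤ R)
    (hA : ∀ x ∈ A, ‖x‖ ≤ R) (hfin : μ A ≠ ∞) : ‖⨍ x in A, x ∂μ‖ ≤ R := by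
  rw [setAverage_eq, norm_smul, norm_inv, Real.norm_of_nonneg measureReal_nonneg]
  have h := norm_setIntegral_le_of_norm_le_const (μ := μ) (f := fun x => x) hfin.lt_top hA
  rcases eq_or_lt_of_le (measureReal_nonneg (μ := μ) (s := A)) with h0 | h0
  · rw [← h0]; simpa using hR
  · rw [inv_mul_le_iff₀ h0]; linarith

theorem measureReal_homothety_image [BorelSpace E] {k : ℝ} (hk : 0 ≤ k) (q : E) {r : ℝ}
    (hr : 0 < r) (A : Set E) : (μH[k] : Measure E).real (AffineMap.homothety q r '' A)
      = r ^ k * (μH[k] : Measure E).real A := by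
  rw [measureReal_def, hausdorffMeasure_homothety_image hk q hr.ne', ENNReal.smul_def,
    smul_eq_mul, ENNReal.toReal_mul, measureReal_def, ENNReal.coe_toReal, NNReal.coe_rpow,
    coe_nnnorm, Real.norm_of_nonneg hr.le]

variable [BorelSpace E] [SecondCountableTopology E]

/-- Enlarging a bounded set moves its average by a multiple of the added measure. -/
theorem measureReal_mul_norm_setAverage_sub_le {μ : Measure E} {A B : Set E}
    (hAm : MeasurableSet A) (hBm : MeasurableSet B) (hAB : A ⊆ B) {R : ℝ} (hR : 0 ≤ R)
    (hB : ∀ x ∈ B, ‖x‖ ≤ R) (hA0 : μ A ≠ 0) (hfin : μ B ≠ ∞) :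
    μ.real B * ‖(⨍ x in A, x ∂μ) - ⨍ x in B, x ∂μ‖ ≤ 2 * R * (μ.real B - μ.real A) := by
  have hAfin : μ A ≠ ∞ := measure_ne_top_of_subset hAB hfin
  have hA0' : μ.real A ≠ 0 := by simp [measureReal_def, ENNReal.toReal_eq_zero_iff, hA0, hAfin]
  have hB0' : μ.real B ≠ 0 := by
    have : μ B ≠ 0 := fun h => hA0 (measure_mono_null hAB h)
    simp [measureReal_def, ENNReal.toReal_eq_zero_iff, this, hfin]
  have hdiff : ∫ x in B \ A, x ∂μ = (∫ x in B, x ∂μ) - ∫ x in A, x ∂μ :=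
    setIntegral_sdiff hAm (integrableOn_id_of_norm_le hBm hB hfin) hAB
  have hmd : μ.real (B \ A) = μ.real B - μ.real A := measureReal_sdiff hAB hAm hfin
  have hcA := norm_setAverage_id_le hR (fun x hx => hB x (hAB hx)) hAfin
  have key : μ.real B • ((⨍ x in A, x ∂μ) - ⨍ x in B, x ∂μ)
      = (μ.real B - μ.real A) • (⨍ x in A, x ∂μ) - ∫ x in B \ A, x ∂μ := by
    rw [hdiff, setAverage_eq, setAverage_eq, smul_sub, sub_smul, smul_inv_smul₀ hA0',
      smul_inv_smul₀ hB0']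
    abel
  have hI : ‖∫ x in B \ A, x ∂μ‖ ≤ R * (μ.real B - μ.real A) := by
    rw [← hmd]
    exact norm_setIntegral_le_of_norm_le_const
      (measure_ne_top_of_subset sdiff_subset hfin).lt_top fun x hx => hB x hx.1
  have hpos : 0 ≤ μ.real B - μ.real A := hmd ▸ measureReal_nonneg
  calc μ.real B * ‖(⨍ x in A, x ∂μ) - ⨍ x in B, x ∂μ‖
      = ‖μ.real B • ((⨍ x in A, x ∂μ) - ⨍ x in B, x ∂μ)‖ := by
        rw [norm_smul, Real.norm_of_nonneg measureReal_nonneg]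
    _ ≤ (μ.real B - μ.real A) * ‖⨍ x in A, x ∂μ‖ + ‖∫ x in B \ A, x ∂μ‖ := by
        rw [key]
        refine (norm_sub_le _ _).trans_eq ?_
        rw [norm_smul, Real.norm_of_nonneg hpos]
    _ ≤ 2 * R * (μ.real B - μ.real A) := by
        have := mul_le_mul_of_nonneg_left hcA hpos
        linarith

variable [CompleteSpace E]

/-- The average of the identity against Hausdorff measure commutes with homotheties. -/
theorem setAverage_id_homothety_image {k : ℝ} (hk : 0 ≤ k) {A : Set E} (hAm : MeasurableSet A)
    {R : ℝ} (hA : ∀ x ∈ A, ‖x‖ ≤ R) (h0 : (μH[k] : Measure E) A ≠ 0)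
    (hfin : (μH[k] : Measure E) A ≠ ∞) (q : E) {r : ℝ} (hr : 0 < r) :
    (⨍ x in AffineMap.homothety q r '' A, x ∂(μH[k] : Measure E))
      = AffineMap.homothety q r (⨍ x in A, x ∂(μH[k] : Measure E)) := by
  set μ : Measure E := μH[k]
  let e : E ≃ₜ E :=
    { toFun := AffineMap.homothety q r
      invFun := AffineMap.homothety q r⁻¹
      left_inv := fun x => by
        rw [← AffineMap.homothety_mul_apply, inv_mul_cancel₀ hr.ne']; simp
      right_inv := fun x => by
        rw [← AffineMap.homothety_mul_apply, mul_inv_cancel₀ hr.ne']; simp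
      continuous_toFun := AffineMap.homothety_continuous _ _
      continuous_invFun := AffineMap.homothety_continuous _ _ }
  have hemb : MeasurableEmbedding (AffineMap.homothety q r : E → E) := e.measurableEmbedding
  have hmap : μ = ‖r‖₊ ^ k • Measure.map (AffineMap.homothety q r) μ := by
    have h1 : ‖r‖₊ ^ k * ‖r‖₊⁻¹ ^ k = 1 := by
      rw [← NNReal.mul_rpow, mul_inv_cancel₀ (by simpa using hr.ne'), NNReal.one_rpow]
    rw [map_homothety_hausdorffMeasure hk q hr.ne', smul_smul, h1, one_smul]
  have hA0 : μ.real A ≠ 0 := by simp [measureReal_def, ENNReal.toReal_eq_zero_iff, h0, hfin]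
  have hV : μ.real (AffineMap.homothety q r '' A) = r ^ k * μ.real A :=
    measureReal_homothety_image hk q hr A
  have hr0 : r ^ k ≠ 0 := (Real.rpow_pos_of_pos hr k).ne'
  have hint : ∫ x in AffineMap.homothety q r '' A, x ∂μ
      = r ^ k • ∫ x in A, AffineMap.homothety q r x ∂μ := by
    conv_lhs => rw [hmap]
    rw [Measure.restrict_smul, integral_smul_nnreal_measure, hemb.setIntegral_map,
      preimage_image_eq _ hemb.injective, NNReal.smul_def, NNReal.coe_rpow, coe_nnnorm,
      Real.norm_of_nonneg hr.le]
  have hform : ∀ x : E, AffineMap.homothety q r x = r • x + (1 - r) • q := fun x => by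
    rw [AffineMap.homothety_apply]; simp only [vsub_eq_sub, vadd_eq_add]; module
  have hid := integrableOn_id_of_norm_le hAm hA hfin
  rw [setAverage_eq, setAverage_eq, hV, hint, smul_smul, mul_inv_rev, mul_assoc,
    inv_mul_cancel₀ hr0, mul_one]
  simp only [hform]
  have hsum : ∫ x in A, (r • x + (1 - r) • q) ∂μ
      = (∫ x in A, r • x ∂μ) + ∫ _ in A, (1 - r) • q ∂μ :=
    integral_add (hid.smul r) (integrableOn_const hfin)
  rw [hsum, integral_smul, setIntegral_const, smul_add, smul_comm, inv_smul_smul₀ hA0]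

/-- Two bounded sets, each containing a copy of the other contracted with ratio `r`, have
averages at distance `O(1 - r)`. -/
theorem norm_setAverage_sub_le_of_homothety {n : ℕ} {A B : Set E} (hA : IsCompact A)
    (hB : IsCompact B) {R : ℝ} (hR : 0 ≤ R) (hAR : ∀ x ∈ A, ‖x‖ ≤ R) (hBR : ∀ x ∈ B, ‖x‖ ≤ R)
    {r : ℝ} (hr : 0 < r) (hr1 : r ≤ 1) {p q : E} (hq : ‖q‖ ≤ R)
    (hAB : AffineMap.homothety q r '' A ⊆ B) (hBA : AffineMap.homothety p r '' B ⊆ A) :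
    ‖(⨍ x in A, x ∂(μH[n] : Measure E)) - ⨍ x in B, x ∂(μH[n] : Measure E)‖
      ≤ (1 - r) * (2 * R * (1 + 2 * n)) := by
  set μ : Measure E := μH[n] with hμ
  have hn : (0 : ℝ) ≤ n := n.cast_nonneg
  have hc0 : (‖r‖₊ ^ (n : ℝ) : ℝ≥0) ≠ 0 := (NNReal.rpow_pos (by simpa using hr.ne')).ne'
  have himage : ∀ (x : E) (S : Set E),
      μ (AffineMap.homothety x r '' S) = (‖r‖₊ ^ (n : ℝ) : ℝ≥0) * μ S := fun x S => by
    rw [hμ, hausdorffMeasure_homothety_image hn x hr.ne', ENNReal.smul_def, smul_eq_mul]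
  have hleAB : (‖r‖₊ ^ (n : ℝ) : ℝ≥0) * μ A ≤ μ B := himage q A ▸ measure_mono hAB
  have hleBA : (‖r‖₊ ^ (n : ℝ) : ℝ≥0) * μ B ≤ μ A := himage p B ▸ measure_mono hBA
  have hc0' : ((‖r‖₊ ^ (n : ℝ) : ℝ≥0) : ℝ≥0∞) ≠ 0 := by exact_mod_cast hc0
  have hrhs : 0 ≤ (1 - r) * (2 * R * (1 + 2 * n)) :=
    mul_nonneg (by linarith) (by positivity)
  by_cases hA0 : μ A = 0
  · have hB0 : μ B = 0 := by
      rw [hA0] at hleBA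
      exact (mul_eq_zero.1 (le_zero_iff.1 hleBA)).resolve_left hc0'
    simpa [setAverage_eq, measureReal_def, hA0, hB0] using hrhs
  by_cases hAt : μ A = ∞
  · have hBt : μ B = ∞ := by
      rw [hAt, ENNReal.mul_top hc0'] at hleAB
      exact top_le_iff.1 hleAB
    simpa [setAverage_eq, measureReal_def, hAt, hBt] using hrhs
  have hBt : μ B ≠ ∞ := by
    intro h
    rw [h, ENNReal.mul_top hc0'] at hleBA
    exact hAt (top_le_iff.1 hleBA)
  have hAi : IsCompact (AffineMap.homothety q r '' A) :=
    hA.image (AffineMap.homothety_continuous q r)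
  have hAi0 : μ (AffineMap.homothety q r '' A) ≠ 0 := by
    rw [himage]; exact mul_ne_zero hc0' hA0
  have hB0 : 0 < μ.real B :=
    ENNReal.toReal_pos (fun h => hAi0 (measure_mono_null hAB h)) hBt
  have hVA : μ.real (AffineMap.homothety q r '' A) = r ^ n * μ.real A := by
    simpa using measureReal_homothety_image hn q hr A
  have hVB : r ^ n * μ.real B ≤ μ.real A := by
    rw [← Real.rpow_natCast, ← measureReal_homothety_image hn p hr B]
    exact measureReal_mono hBA hAt
  have hber : 1 + (2 * n) * (r - 1) ≤ r ^ n * r ^ n := by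
    have := one_add_mul_le_pow (a := r - 1) (by linarith) (2 * n)
    rw [add_sub_cancel, two_mul n, pow_add] at this
    push_cast at this
    linarith
  have hloss : μ.real B - μ.real (AffineMap.homothety q r '' A)
      ≤ 2 * n * (1 - r) * μ.real B := by
    have h1 := mul_le_mul_of_nonneg_left hVB (pow_nonneg hr.le n)
    have h2 := mul_le_mul_of_nonneg_right hber hB0.le
    rw [hVA]
    nlinarith
  have h1 := measureReal_mul_norm_setAverage_sub_le hAi.measurableSet hB.measurableSet hAB hR hBR
    hAi0 hBt
  rw [setAverage_id_homothety_image hn hA.measurableSet hAR hA0 hAt q hr] at h1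
  have h2 : ‖AffineMap.homothety q r (⨍ x in A, x ∂μ) - ⨍ x in B, x ∂μ‖
      ≤ 2 * R * (2 * n * (1 - r)) := by
    refine le_of_mul_le_mul_left (h1.trans ?_) hB0
    have := mul_le_mul_of_nonneg_left hloss (by linarith : 0 ≤ 2 * R)
    linarith
  have h3 := norm_sub_homothety_le hr1 hq (norm_setAverage_id_le hR hAR hAt)
  have h4 := norm_sub_le_norm_sub_add_norm_sub (⨍ x in A, x ∂μ)
    (AffineMap.homothety q r (⨍ x in A, x ∂μ)) (⨍ x in B, x ∂μ)
  linarith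

end Average

theorem centroid_succ_eq_setAverage {n : ℕ} (L : Set (EuclideanSpace ℝ (Fin (n + 1)))) :
    centroid (n + 1) L = ⨍ x in L, x ∂(μH[n] : Measure (EuclideanSpace ℝ (Fin (n + 1)))) := by
  have : ((n + 1 : ℕ) : ℝ) - 1 = n := by simp
  rw [centroid, this, setAverage_eq, measureReal_def]

/-- Lipschitz bounds for parallel sections at heights `s` and `t`. -/
theorem parallel_sections_lipschitz {n : ℕ} {K : Set (EuclideanSpace ℝ (Fin (n + 1)))}
    (hKconv : Convex ℝ K) (hKcomp : IsCompact K) {δ R : ℝ} (hδ : 0 < δ) (hR : 0 ≤ R)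
    (hKR : ∀ x ∈ K, ‖x‖ ≤ R) {u : EuclideanSpace ℝ (Fin (n + 1))} (hu : ‖u‖ = 1) {s t : ℝ}
    (hs : ({z | ⟪z, u⟫ = s} ∩ innerEnvelope K δ).Nonempty)
    (ht : ({z | ⟪z, u⟫ = t} ∩ innerEnvelope K δ).Nonempty) :
    Metric.hausdorffEDist (K ∩ {z | ⟪z, u⟫ = s}) (K ∩ {z | ⟪z, u⟫ = t})
        ≤ ENNReal.ofReal (|s - t| / δ * (2 * R)) ∧
      edist (centroid (n + 1) (K ∩ {z | ⟪z, u⟫ = s})) (centroid (n + 1) (K ∩ {z | ⟪z, u⟫ = t}))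
        ≤ ENNReal.ofReal (|s - t| / δ * (2 * R * (1 + 2 * n))) := by
  obtain ⟨a, hau, haK⟩ := hs
  obtain ⟨b, hbu, hbK⟩ := ht
  obtain ⟨q, hqK, hq⟩ := exists_homothety_image_section_subset hKconv hδ hu hbK hbu s
  obtain ⟨p, hpK, hp⟩ := exists_homothety_image_section_subset hKconv hδ hu haK hau t
  rw [abs_sub_comm] at hp
  have hr : 0 < δ / (|s - t| + δ) := by positivity
  have hr1 : δ / (|s - t| + δ) ≤ 1 :=
    (div_le_one (by positivity)).2 (by linarith [abs_nonneg (s - t)])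
  have hgap := one_sub_div_abs_add_le hδ (s - t)
  have hcomp : ∀ c : ℝ, IsCompact (K ∩ {z | ⟪z, u⟫ = c}) := fun c =>
    hKcomp.inter_right (isClosed_eq (by fun_prop) continuous_const)
  have hmove : ∀ y ∈ K, ∀ x ∈ K, edist x (AffineMap.homothety y (δ / (|s - t| + δ)) x)
      ≤ ENNReal.ofReal (|s - t| / δ * (2 * R)) := fun y hy x hx => by
    rw [edist_dist, dist_eq_norm]
    exact ENNReal.ofReal_le_ofReal ((norm_sub_homothety_le hr1 (hKR y hy) (hKR x hx)).trans
      (mul_le_mul_of_nonneg_right hgap (by linarith)))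
  constructor
  · exact Metric.hausdorffEDist_le_of_mem_edist
      (fun x hx => ⟨_, hq (mem_image_of_mem _ hx), hmove q hqK x hx.1⟩)
      (fun x hx => ⟨_, hp (mem_image_of_mem _ hx), hmove p hpK x hx.1⟩)
  · rw [edist_dist, dist_eq_norm, centroid_succ_eq_setAverage, centroid_succ_eq_setAverage]
    refine ENNReal.ofReal_le_ofReal ((norm_setAverage_sub_le_of_homothety (hcomp s) (hcomp t) hR
      (fun x hx => hKR x hx.1) (fun x hx => hKR x hx.1) hr hr1 (hKR q hqK) hq hp).trans ?_)
    exact mul_le_mul_of_nonneg_right hgap (by positivity)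

/-- Lipschitz dependence of hyperplane sections of a convex body, and of their centroids,
on the hyperplane, for hyperplanes meeting the inner envelope `K^{−δ}`. -/
theorem sections_and_centroids_lipschitz
    {d : ℕ} (K : Set (EuclideanSpace ℝ (Fin d)))
    (hKconv : Convex ℝ K) (hKcomp : IsCompact K) (hKint : (interior K).Nonempty)
    (δ : ℝ) (hδ : 0 < δ) (hne : (innerEnvelope K δ).Nonempty) :
    ∃ c₁ c₂ : ℝ≥0, 0 < c₁ ∧ 0 < c₂ ∧
      ∀ (u₁ u₂ : EuclideanSpace ℝ (Fin d)) (t₁ t₂ : ℝ), ‖u₁‖ = 1 → ‖u₂‖ = 1 →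
        ({z | ⟪z, u₁⟫ = t₁} ∩ innerEnvelope K δ).Nonempty →
        ({z | ⟪z, u₂⟫ = t₂} ∩ innerEnvelope K δ).Nonempty →
        EMetric.hausdorffEdist (K ∩ {z | ⟪z, u₁⟫ = t₁}) (K ∩ {z | ⟪z, u₂⟫ = t₂}) ≤
          (c₁ : ℝ≥0∞) * EMetric.hausdorffEdist {z | ⟪z, u₁⟫ = t₁} {z | ⟪z, u₂⟫ = t₂} ∧
        edist (centroid d (K ∩ {z | ⟪z, u₁⟫ = t₁})) (centroid d (K ∩ {z | ⟪z, u₂⟫ = t₂})) ≤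
          (c₂ : ℝ≥0∞) * EMetric.hausdorffEdist {z | ⟪z, u₁⟫ = t₁} {z | ⟪z, u₂⟫ = t₂} := by
  obtain ⟨R, hR, hKR⟩ := hKcomp.isBounded.exists_pos_norm_le
  rcases d with _ | n
  · refine ⟨1, 1, one_pos, one_pos, fun u₁ _ _ _ hu₁ => ?_⟩
    simp [Subsingleton.elim u₁ 0] at hu₁
  have hc₁ : 0 < 2 * R / δ := by positivity
  have hc₂ : 0 < 2 * R * (1 + 2 * n) / δ := by positivity
  refine ⟨(2 * R / δ).toNNReal, (2 * R * (1 + 2 * n) / δ).toNNReal, Real.toNNReal_pos.2 hc₁,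
    Real.toNNReal_pos.2 hc₂, fun u₁ u₂ t₁ t₂ hu₁ hu₂ h₁ h₂ => ?_⟩
  have parallel : ∀ t : ℝ, {z | ⟪z, u₂⟫ = t₂} = {z | ⟪z, u₁⟫ = t} →
      Metric.hausdorffEDist (K ∩ {z | ⟪z, u₁⟫ = t₁}) (K ∩ {z | ⟪z, u₂⟫ = t₂}) ≤
          ((2 * R / δ).toNNReal : ℝ≥0∞) *
            Metric.hausdorffEDist {z | ⟪z, u₁⟫ = t₁} {z | ⟪z, u₂⟫ = t₂} ∧
        edist (centroid (n + 1) (K ∩ {z | ⟪z, u₁⟫ = t₁}))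
            (centroid (n + 1) (K ∩ {z | ⟪z, u₂⟫ = t₂})) ≤
          ((2 * R * (1 + 2 * n) / δ).toNNReal : ℝ≥0∞) *
            Metric.hausdorffEDist {z | ⟪z, u₁⟫ = t₁} {z | ⟪z, u₂⟫ = t₂} := by
    intro t h
    rw [h] at h₂ ⊢
    have hlow := ofReal_abs_sub_le_hausdorffEDist hu₁ t₁ t
    obtain ⟨hsec, hcen⟩ := parallel_sections_lipschitz hKconv hKcomp hδ hR.le hKR hu₁ h₁ h₂
    refine ⟨hsec.trans (le_trans (le_of_eq ?_) (mul_le_mul_right hlow _)),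
      hcen.trans (le_trans (le_of_eq ?_) (mul_le_mul_right hlow _))⟩
    · rw [← ENNReal.ofReal, ← ENNReal.ofReal_mul hc₁.le]
      congr 1; ring
    · rw [← ENNReal.ofReal, ← ENNReal.ofReal_mul hc₂.le]
      congr 1; ring
  by_cases hpos : u₂ = u₁
  · exact parallel t₂ (by rw [hpos])
  by_cases hneg : u₂ = -u₁
  · refine parallel (-t₂) ?_
    ext z
    simp [hneg, inner_neg_right, neg_eq_iff_eq_neg]
  have htop : Metric.hausdorffEDist {z | ⟪z, u₁⟫ = t₁} {z | ⟪z, u₂⟫ = t₂} = ⊤ :=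
    hausdorffEDist_hyperplane_eq_top hu₁ hu₂ hpos hneg t₁ t₂
  change Metric.hausdorffEDist _ _ ≤ _ * Metric.hausdorffEDist _ _ ∧
    _ ≤ _ * Metric.hausdorffEDist _ _
  rw [htop, ENNReal.mul_top (by simpa using hc₁), ENNReal.mul_top (by simpa using hc₂)]
  exact ⟨le_top, le_top⟩

end
end
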